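/- arXiv:1205.6884 — 2 statements merged into one kernel-verified Lean document; each statement's English description precedes it below -/
import Mathlib

section
/- Let Λ be the 2L × L rectangle obtained by attaching a side-L square to the left of Λ_L = {1,…,L}², let H' = H(L) + 1, and let π_Λ^{H',f} be the SOS measure on Λ with constant boundary condition H', floor at 0, ceiling at n⁺ = ⌊log L⌋, and external field f(η) = (1/L)·Σ_{y ∈ Λ} Σ_{j=1}^{n⁺ − H(L)} e^{−βj}·1_{η_y ≤ H(L) + j}. Then for β sufficiently large and for any sufficiently large constant ℓ, lim_{L→∞} π_Λ^{H',f}( the restriction of η to Λ_L belongs to G⁺_ℓ ) = 1. -/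
open scoped Classical
open Filter

noncomputable section

namespace SOSPaper

/-- Sites of the lattice `ℤ²`. -/
abbrev Site : Type := ℤ × ℤ

/-- Height configurations on `ℤ²`. -/
abbrev Config : Type := Site → ℤ

/-- Nearest-neighbour adjacency on `ℤ²`. -/
def SiteAdj (x y : Site) : Prop := (x.1 - y.1).natAbs + (x.2 - y.2).natAbs = 1

/-- The four nearest neighbours of a site. -/
def nbrs (x : Site) : Finset Site :=
  {(x.1 + 1, x.2), (x.1 - 1, x.2), (x.1, x.2 + 1), (x.1, x.2 - 1)}

/-- The SOS Hamiltonian on `Λ` with boundary condition `ξ`: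
`H_Λ^ξ(η) = (1/2) Σ_{x,y∈Λ adjacent} |η_x-η_y| + Σ_{x∈Λ, y∉Λ adjacent} |η_x-ξ_y|`. -/
def sosH (Λ : Finset Site) (ξ : Config) (η : Config) : ℝ :=
  (1 / 2) * ∑ x ∈ Λ, ∑ y ∈ (nbrs x).filter (fun y => y ∈ Λ), ((|η x - η y| : ℤ) : ℝ)
    + ∑ x ∈ Λ, ∑ y ∈ (nbrs x).filter (fun y => y ∉ Λ), ((|η x - ξ y| : ℤ) : ℝ)

/-- Extension of `g : Λ → ℤ` by the boundary condition `ξ` off `Λ`. -/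
def extendC (Λ : Finset Site) (ξ : Config) (g : {x // x ∈ Λ} → ℤ) : Config :=
  fun x => if h : x ∈ Λ then g ⟨x, h⟩ else ξ x

/-- Gibbs weight `exp(-β·H_Λ^ξ(η) + F(η))`, subject to the single-site constraint
`η_x ∈ K` for all `x ∈ Λ` (floor/ceiling constraints); `F` is an extra external field
(`F = 0` for the plain SOS model). -/
def gWeight (β : ℝ) (Λ : Finset Site) (ξ : Config) (K : Set ℤ) (F : Config → ℝ)
    (η : Config) : ℝ :=
  if ∀ x ∈ Λ, η x ∈ K then Real.exp (-β * sosH Λ ξ η + F η) else 0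

/-- The Gibbs probability of a set `A` of configurations: normalized sum of Gibbs
weights over all configurations agreeing with `ξ` off `Λ`. -/
def gProb (β : ℝ) (Λ : Finset Site) (ξ : Config) (K : Set ℤ) (F : Config → ℝ)
    (A : Set Config) : ℝ :=
  (∑' g : {x // x ∈ Λ} → ℤ, Set.indicator A (gWeight β Λ ξ K F) (extendC Λ ξ g))
    / ∑' g : {x // x ∈ Λ} → ℤ, gWeight β Λ ξ K F (extendC Λ ξ g)

/-- The box `Λ_L = {1,…,L}²`. -/
def box (L : ℕ) : Finset Site := Finset.Icc ((1 : ℤ), (1 : ℤ)) ((L : ℤ), (L : ℤ))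

/-- The equilibrium height `H(L) = ⌊log L / (4β)⌋`. -/
def eqHt (β : ℝ) (L : ℕ) : ℤ := ⌊Real.log L / (4 * β)⌋

/-- Heat-bath update probability at site `x` for new value `v`: the Gibbs conditional
probability of the value `v` at `x` given the heights at all other sites. -/
def heatBath (β : ℝ) (Λ : Finset Site) (ξ : Config) (K : Set ℤ) (F : Config → ℝ)
    (η : Config) (x : Site) (v : ℤ) : ℝ :=
  gWeight β Λ ξ K F (Function.update η x v)
    / ∑' w : ℤ, gWeight β Λ ξ K F (Function.update η x w)

/-- One step of the Glauber (heat-bath) dynamics: pick a uniformly random site `x ∈ Λ`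
and resample the height at `x` from the Gibbs conditional distribution. -/
def glauber (β : ℝ) (Λ : Finset Site) (ξ : Config) (K : Set ℤ) (F : Config → ℝ)
    (η σ : Config) : ℝ :=
  ((Λ.card : ℝ))⁻¹ *
    ∑ x ∈ Λ, (if σ = Function.update η x (σ x) then heatBath β Λ ξ K F η x (σ x) else 0)

/-- `t`-step transition probabilities of a Markov kernel `P`. -/
def chainLaw (P : Config → Config → ℝ) : ℕ → Config → Config → ℝ
  | 0, η, σ => if σ = η then 1 else 0
  | (t + 1), η, σ => ∑' τ : Config, chainLaw P t η τ * P τ σ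

/-- The law at time `t` of the chain started from `η`, evaluated on a set `A`. -/
def lawProb (P : Config → Config → ℝ) (t : ℕ) (η : Config) (A : Set Config) : ℝ :=
  ∑' σ : Config, Set.indicator A (chainLaw P t η) σ

/-- Total variation distance between two set functions. -/
def tvDist (μ ν : Set Config → ℝ) : ℝ := ⨆ A : Set Config, |μ A - ν A|

/-- The state space of the dynamics: configurations agreeing with `ξ` off `Λ` and
obeying the constraint `K` on `Λ`. -/
def stateSpace (Λ : Finset Site) (ξ : Config) (K : Set ℤ) : Set Config :=
  {η | (∀ x ∈ Λ, η x ∈ K) ∧ ∀ x ∉ Λ, η x = ξ x}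

/-- The mixing time of the Glauber dynamics: first time at which the total variation
distance to equilibrium is at most `1/(2e)`, uniformly in the initial configuration. -/
def mixingTime (β : ℝ) (Λ : Finset Site) (ξ : Config) (K : Set ℤ) (F : Config → ℝ) : ℕ :=
  sInf {t : ℕ | 0 < t ∧ ∀ η ∈ stateSpace Λ ξ K,
    tvDist (lawProb (glauber β Λ ξ K F) t η) (gProb β Λ ξ K F) ≤ (2 * Real.exp 1)⁻¹}

/-- Expectation with respect to the Gibbs measure. -/
def gExp (β : ℝ) (Λ : Finset Site) (ξ : Config) (K : Set ℤ) (F : Config → ℝ)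
    (f : Config → ℝ) : ℝ :=
  (∑' g : {x // x ∈ Λ} → ℤ, gWeight β Λ ξ K F (extendC Λ ξ g) * f (extendC Λ ξ g))
    / ∑' g : {x // x ∈ Λ} → ℤ, gWeight β Λ ξ K F (extendC Λ ξ g)

/-- Action of a Markov kernel on a function. -/
def applyK (P : Config → Config → ℝ) (f : Config → ℝ) (η : Config) : ℝ :=
  ∑' σ : Config, P η σ * f σ

/-- The Dirichlet form `π(f(I−P)f)` of the Glauber dynamics. -/
def dirichlet (β : ℝ) (Λ : Finset Site) (ξ : Config) (K : Set ℤ) (F : Config → ℝ)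
    (f : Config → ℝ) : ℝ :=
  gExp β Λ ξ K F (fun η => f η * (f η - applyK (glauber β Λ ξ K F) f η))

/-- The variance of `f` under the Gibbs measure. -/
def gVar (β : ℝ) (Λ : Finset Site) (ξ : Config) (K : Set ℤ) (F : Config → ℝ)
    (f : Config → ℝ) : ℝ :=
  gExp β Λ ξ K F (fun η => (f η - gExp β Λ ξ K F f) ^ 2)

/-- The spectral gap of the Glauber dynamics, via the variational characterization
`gap = inf_{f non-constant} π(f(I−P)f)/Var_π(f)`. -/
def spectralGap (β : ℝ) (Λ : Finset Site) (ξ : Config) (K : Set ℤ) (F : Config → ℝ) : ℝ :=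
  ⨅ f : {f : Config → ℝ //
      ¬ ∀ η ∈ stateSpace Λ ξ K, ∀ η' ∈ stateSpace Λ ξ K, f η = f η'},
    dirichlet β Λ ξ K F f.1 / gVar β Λ ξ K F f.1

/-- The relaxation time: inverse spectral gap. -/
def relaxTime (β : ℝ) (Λ : Finset Site) (ξ : Config) (K : Set ℤ) (F : Config → ℝ) : ℝ :=
  (spectralGap β Λ ξ K F)⁻¹

/-- The trajectory determined by the initial configuration `η₀` and the sequence of
subsequent states `f`. -/
def trajOf (η₀ : Config) (f : ℕ → Config) : ℕ → Config
  | 0 => η₀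
  | (t + 1) => f t

/-- The steps function obtained from finitely many steps, extended arbitrarily. -/
def extSteps (N : ℕ) (η₀ : Config) (f : Fin N → Config) : ℕ → Config :=
  fun t => if h : t < N then f ⟨t, h⟩ else η₀

/-- The probability that the trajectory of the chain started at `η₀` satisfies the
event `E` (an event depending only on the first `N` steps). -/
def pathProb (P : Config → Config → ℝ) (η₀ : Config) (N : ℕ)
    (E : (ℕ → Config) → Prop) : ℝ :=
  ∑' f : Fin N → Config,
    if E (trajOf η₀ (extSteps N η₀ f)) then
      ∏ t ∈ Finset.range N,
        P (trajOf η₀ (extSteps N η₀ f) t) (trajOf η₀ (extSteps N η₀ f) (t + 1))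
    else 0

/-- The ceiling height `n⁺ = ⌊log L⌋`. -/
def ceilN (L : ℕ) : ℤ := ⌊Real.log L⌋

/-- The external field `f(η) = (1/L) Σ_{y∈Λ} Σ_{j=1}^{n⁺−H(L)} e^{−βj} 1_{η_y ≤ H(L)+j}`. -/
def fieldF (β : ℝ) (L : ℕ) (Λ : Finset Site) (η : Config) : ℝ :=
  (L : ℝ)⁻¹ * ∑ y ∈ Λ, ∑ j ∈ Finset.Icc (1 : ℤ) (ceilN L - eqHt β L),
    Real.exp (-β * (j : ℝ)) * (if η y ≤ eqHt β L + j then 1 else 0)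

/-- One step of the Glauber dynamics for the modified SOS measure `π_{Λ_L}^{0,f}`
(zero boundary conditions, floor at `0`, ceiling at `n⁺ = ⌊log L⌋`, field `f`). -/
def glauberMod (β : ℝ) (L : ℕ) : Config → Config → ℝ :=
  glauber β (box L) 0 (Set.Icc 0 (ceilN L)) (fieldF β L (box L))

/-- Mixing time of the Glauber dynamics for the modified SOS measure `π_{Λ_L}^{0,f}`. -/
def TmixMod (β : ℝ) (L : ℕ) : ℕ :=
  mixingTime β (box L) 0 (Set.Icc 0 (ceilN L)) (fieldF β L (box L))

/-- `k`-fold iterated logarithm. -/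
def iterLog : ℕ → ℝ → ℝ
  | 0, x => x
  | (k + 1), x => Real.log (iterLog k x)

/-- `log^{(k)}(x) = max(1, log log … log x)` (`k` iterations). -/
def logK (k : ℕ) (x : ℝ) : ℝ := max 1 (iterLog k x)

/-- The inductive statement `F_{k,a,A}`: for every `L`, the mixing time of the Glauber
dynamics for the modified SOS measure satisfies `T_mix(L) ≤ L^a exp(A·L·log^{(k)} L)`. -/
def Fstmt (β a A : ℝ) (k : ℕ) : Prop :=
  ∀ L : ℕ, (TmixMod β L : ℝ) ≤ (L : ℝ) ^ a * Real.exp (A * L * logK k L)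

/-- The diagonal line `R_i = {x ∈ Λ_L : x₂ = x₁ + L − i}`. -/
def diagR (L : ℕ) (i : ℕ) : Finset Site :=
  (box L).filter (fun x => x.2 = x.1 + (L : ℤ) - (i : ℤ))

/-- `G⁻_ℓ`: on every diagonal, `Σ_x max(H − η_x, 0) ≤ Lℓ`. -/
def Gminus (β : ℝ) (L : ℕ) (ℓ : ℝ) : Set Config :=
  {η | ∀ i ∈ Finset.Icc 1 (2 * L - 1),
    ((∑ x ∈ diagR L i, max (eqHt β L - η x) 0 : ℤ) : ℝ) ≤ (L : ℝ) * ℓ}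

/-- `G⁺_ℓ`: on every diagonal, `Σ_x max(η_x − H, 0) ≤ Lℓ`. -/
def Gplus (β : ℝ) (L : ℕ) (ℓ : ℝ) : Set Config :=
  {η | ∀ i ∈ Finset.Icc 1 (2 * L - 1),
    ((∑ x ∈ diagR L i, max (η x - eqHt β L) 0 : ℤ) : ℝ) ≤ (L : ℝ) * ℓ}

/-- `G_ℓ`: on every diagonal, `Σ_x |η_x − H| ≤ Lℓ`. -/
def Gabs (β : ℝ) (L : ℕ) (ℓ : ℝ) : Set Config :=
  {η | ∀ i ∈ Finset.Icc 1 (2 * L - 1),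
    ((∑ x ∈ diagR L i, |η x - eqHt β L| : ℤ) : ℝ) ≤ (L : ℝ) * ℓ}

/-- The `2L × L` rectangle obtained by attaching a side-`L` square to the left of
`Λ_L = {1,…,L}²`. -/
def rect2 (L : ℕ) : Finset Site := Finset.Icc (1 - (L : ℤ), (1 : ℤ)) ((L : ℤ), (L : ℤ))


lemma orbit_aux {α : Type*} [DecidableEq α] (f : α → α) (S : Finset α) (hS : ∀ e ∈ S, f e ∈ S)
    (hinj : ∀ a ∈ S, ∀ b ∈ S, f a = f b → a = b) (e : α) (he : e ∈ S) :
    ∃ m : ℕ, 0 < m ∧ Set.InjOn (fun i => f^[i] e) (Finset.range m : Finset ℕ) ∧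
      (Finset.range m).image (fun i => f^[i] e) ⊆ S ∧
      (∀ a ∈ (Finset.range m).image (fun i => f^[i] e),
        f a ∈ (Finset.range m).image (fun i => f^[i] e)) ∧
      (∀ a ∈ S \ (Finset.range m).image (fun i => f^[i] e),
        f a ∈ S \ (Finset.range m).image (fun i => f^[i] e)) := by
  have hit : ∀ i, f^[i] e ∈ S := by
    intro i
    induction i with
    | zero => simpa using he
    | succ n ih => rw [Function.iterate_succ_apply']; exact hS _ ih
  have hmt : Set.MapsTo f (S : Set α) (S : Set α) := fun a ha => hS a ha
  have hper : e ∈ Function.periodicPts f := by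
    have hFi : Function.Injective (hmt.restrict f S S) := by
      intro a b hab
      apply Subtype.ext
      apply hinj _ a.2 _ b.2
      simpa using congrArg Subtype.val hab
    obtain ⟨n, hn, hp⟩ := hFi.mem_periodicPts ⟨e, he⟩
    refine ⟨n, hn, ?_⟩
    have h2 : ∀ n (x : (S : Set α)), (((hmt.restrict f S S)^[n] x : (S : Set α)) : α) = f^[n] x := by
      intro n
      induction n with
      | zero => intro x; rfl
      | succ n ih => intro x; rw [Function.iterate_succ_apply, ih, Function.iterate_succ_apply]; rfl
    have h3 := congrArg Subtype.val hp
    rw [h2] at h3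
    exact h3
  set m := Function.minimalPeriod f e with hm
  have hmpos : 0 < m := Function.minimalPeriod_pos_of_mem_periodicPts hper
  have hfm : f^[m] e = e := Function.isPeriodicPt_minimalPeriod f e
  refine ⟨m, hmpos, ?_, ?_, ?_, ?_⟩
  · have := Function.iterate_injOn_Iio_minimalPeriod (f := f) (x := e)
    intro i hi j hj hij
    apply this (by simpa using hi) (by simpa using hj) hij
  · intro a ha
    obtain ⟨i, _, rfl⟩ := Finset.mem_image.1 ha
    exact hit i
  · intro a ha
    obtain ⟨i, hi, rfl⟩ := Finset.mem_image.1 ha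
    rw [Finset.mem_range] at hi
    rcases Nat.lt_or_ge (i+1) m with h | h
    · exact Finset.mem_image.2 ⟨i+1, Finset.mem_range.2 h, Function.iterate_succ_apply' f i e⟩
    · have : i + 1 = m := by omega
      refine Finset.mem_image.2 ⟨0, Finset.mem_range.2 hmpos, ?_⟩
      rw [← Function.iterate_succ_apply' f i e, Nat.succ_eq_add_one, this, hfm]; rfl
  · intro a ha
    rw [Finset.mem_sdiff] at ha ⊢
    refine ⟨hS a ha.1, fun h => ha.2 ?_⟩
    obtain ⟨i, hi, hia⟩ := Finset.mem_image.1 h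
    rw [Finset.mem_range] at hi
    rcases i with _ | i
    · refine Finset.mem_image.2 ⟨m - 1, Finset.mem_range.2 (by omega), ?_⟩
      apply hinj _ (hit _) _ ha.1
      have : f (f^[m-1] e) = f^[m] e := by
        rw [← Function.iterate_succ_apply' f]; congr 1; omega
      rw [this, hfm, ← hia]; rfl
    · refine Finset.mem_image.2 ⟨i, Finset.mem_range.2 (by omega), ?_⟩
      apply hinj _ (hit _) _ ha.1
      rw [← hia, ← Function.iterate_succ_apply' f]

def rot (u : Site) : Site := (-u.2, u.1)

def dirs : Finset Site := {(1, 0), (-1, 0), (0, 1), (0, -1)}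

lemma mem_dirs {u : Site} : u ∈ dirs ↔ u = (1,0) ∨ u = (-1,0) ∨ u = (0,1) ∨ u = (0,-1) := by
  simp [dirs]

lemma rot_mem {u : Site} (h : u ∈ dirs) : rot u ∈ dirs := by
  rw [mem_dirs] at *
  rcases h with rfl | rfl | rfl | rfl <;> simp [rot]

lemma neg_mem {u : Site} (h : u ∈ dirs) : -u ∈ dirs := by
  rw [mem_dirs] at *
  rcases h with rfl | rfl | rfl | rfl <;> simp

abbrev DEdge : Type := Site × Site

def move (e : DEdge) (t : Fin 3) : DEdge :=
  if t = 0 then (e.1, rot e.2) else if t = 1 then (e.1 + rot e.2, e.2)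
  else (e.1 + e.2 + rot e.2, - rot e.2)

def turn (A : Set Site) (e : DEdge) : Fin 3 :=
  if e.1 + rot e.2 ∉ A then 0 else if e.1 + e.2 + rot e.2 ∉ A then 1 else 2

def nxt (A : Set Site) (e : DEdge) : DEdge := move e (turn A e)

def bE (A : Set Site) (e : DEdge) : Prop := e.2 ∈ dirs ∧ e.1 ∈ A ∧ e.1 + e.2 ∉ A

lemma nxt_cases (A : Set Site) (e : DEdge) :
    (e.1 + rot e.2 ∉ A ∧ nxt A e = (e.1, rot e.2)) ∨
    (e.1 + rot e.2 ∈ A ∧ e.1 + e.2 + rot e.2 ∉ A ∧ nxt A e = (e.1 + rot e.2, e.2)) ∨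
    (e.1 + rot e.2 ∈ A ∧ e.1 + e.2 + rot e.2 ∈ A ∧
      nxt A e = (e.1 + e.2 + rot e.2, - rot e.2)) := by
  unfold nxt turn move
  by_cases h1 : e.1 + rot e.2 ∈ A <;> by_cases h2 : e.1 + e.2 + rot e.2 ∈ A <;> simp [h1, h2]

lemma nxt_bE {A : Set Site} {e : DEdge} (h : bE A e) : bE A (nxt A e) := by
  obtain ⟨h1, h2, h3⟩ := h
  rcases nxt_cases A e with ⟨a, b⟩ | ⟨a, b, c⟩ | ⟨a, b, c⟩
  · rw [b]; exact ⟨rot_mem h1, h2, a⟩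
  · rw [c]; refine ⟨h1, a, ?_⟩
    have e1 : e.1 + rot e.2 + e.2 = e.1 + e.2 + rot e.2 := by abel
    show e.1 + rot e.2 + e.2 ∉ A
    rw [e1]; exact b
  · rw [c]; refine ⟨neg_mem (rot_mem h1), b, ?_⟩
    have e1 : e.1 + e.2 + rot e.2 + -rot e.2 = e.1 + e.2 := by abel
    show e.1 + e.2 + rot e.2 + -rot e.2 ∉ A
    rw [e1]; exact h3

lemma rot_inj {u v : Site} (h : rot u = rot v) : u = v := by
  simp only [rot, Prod.mk.injEq, neg_inj] at h
  exact Prod.ext h.2 h.1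

def rotI (u : Site) : Site := (u.2, -u.1)

lemma rotI_rot (u : Site) : rotI (rot u) = u := by simp [rot, rotI]

def prv (A : Set Site) (e : DEdge) : DEdge :=
  if e.1 + rotI e.2 ∉ A then (e.1, rotI e.2)
  else if e.1 + e.2 + rotI e.2 ∉ A then (e.1 + rotI e.2, e.2)
  else (e.1 + e.2 + rotI e.2, - rotI e.2)

lemma prv_nxt {A : Set Site} {e : DEdge} (h : bE A e) : prv A (nxt A e) = e := by
  obtain ⟨⟨a1, a2⟩, ⟨u1, u2⟩⟩ := e
  obtain ⟨h1, h2, h3⟩ := h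
  rcases nxt_cases A ((a1, a2), (u1, u2)) with ⟨a, b⟩ | ⟨a, b, c⟩ | ⟨a, b, c⟩
  · rw [b]; simp only [prv, rotI_rot]; rw [if_pos h3]
  · rw [c]
    simp only [prv, rot, rotI, Prod.mk_add_mk] at *
    have e1 : a1 + -u2 + u2 = a1 := by ring
    have e2 : a2 + u1 + -u1 = a2 := by ring
    have e3 : a1 + -u2 + u1 + u2 = a1 + u1 := by ring
    have e4 : a2 + u1 + u2 + -u1 = a2 + u2 := by ring
    simp [e1, e2, e3, e4, h2, h3]
  · rw [c]
    simp only [prv, rot, rotI, Prod.mk_add_mk, Prod.neg_mk, neg_neg] at *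
    have e1 : a1 + u1 + -u2 + -u1 = a1 + -u2 := by ring
    have e2 : a2 + u2 + u1 + -u2 = a2 + u1 := by ring
    have e3 : a1 + u1 + -u2 + u2 + -u1 = a1 := by ring
    have e4 : a2 + u2 + u1 + -u1 + -u2 = a2 := by ring
    simp [e1, e2, h2, a]

lemma nxt_inj {A : Set Site} {e e' : DEdge} (h : bE A e) (h' : bE A e')
    (hh : nxt A e = nxt A e') : e = e' := by
  rw [← prv_nxt h, hh, prv_nxt h']

/-- contribution of a directed dual edge to the winding number around `x` -/
def contr (x : Site) (e : DEdge) : ℤ :=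
  if e.1.2 = x.2 ∧ e.2 = (1, 0) ∧ x.1 ≤ e.1.1 then 1
  else if e.1.2 = x.2 ∧ e.2 = (-1, 0) ∧ x.1 < e.1.1 then -1 else 0

def cr (x u : Site) (e : DEdge) : ℤ :=
  (if e = (x, u) then 1 else 0) - (if e = (x + u, -u) then 1 else 0)

def phi (x : Site) (v : Site) : ℤ := if v.2 = 2 * x.2 + 1 ∧ 2 * x.1 + 1 ≤ v.1 then 1 else 0

def endV (e : DEdge) : Site := (2 * e.1.1 + e.2.1 - e.2.2, 2 * e.1.2 + e.2.2 + e.2.1)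
def staV (e : DEdge) : Site := (2 * e.1.1 + e.2.1 + e.2.2, 2 * e.1.2 + e.2.2 - e.2.1)

lemma sta_nxt (A : Set Site) (e : DEdge) : staV (nxt A e) = endV e := by
  obtain ⟨⟨a1, a2⟩, ⟨u1, u2⟩⟩ := e
  rcases nxt_cases A ((a1, a2), (u1, u2)) with ⟨a, b⟩ | ⟨a, b, c⟩ | ⟨a, b, c⟩
  · rw [b]; simp only [staV, endV, rot]; ext <;> simp only <;> ring
  · rw [c]; simp only [staV, endV, rot, Prod.mk_add_mk]; ext <;> simp only <;> ring
  · rw [c]; simp only [staV, endV, rot, Prod.mk_add_mk, Prod.neg_mk]; ext <;> simp only <;> ring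

lemma contr_h (x : Site) (e : DEdge) (he : e.2 ∈ dirs) :
    contr x e - contr (x + (1,0)) e = cr x (1,0) e := by
  obtain ⟨⟨a1, a2⟩, u⟩ := e
  obtain ⟨x1, x2⟩ := x
  rw [mem_dirs] at he
  simp only at he
  rcases he with rfl | rfl | rfl | rfl <;>
    simp only [contr, cr, Prod.mk_add_mk, Prod.mk.injEq, Prod.neg_mk] <;> norm_num <;>
    split_ifs <;> omega

lemma contr_v (x : Site) (e : DEdge) (he : e.2 ∈ dirs) :
    contr x e - contr (x + (0,1)) e - (phi x (endV e) - phi x (staV e)) = cr x (0,1) e := by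
  obtain ⟨⟨a1, a2⟩, u⟩ := e
  obtain ⟨x1, x2⟩ := x
  rw [mem_dirs] at he
  simp only at he
  rcases he with rfl | rfl | rfl | rfl <;>
    simp only [contr, cr, phi, endV, staV, Prod.mk_add_mk, Prod.mk.injEq, Prod.neg_mk] <;>
    norm_num <;>
    split_ifs <;> omega

def Wd (S : Finset DEdge) (x : Site) : ℤ := ∑ e ∈ S, contr x e

structure Loop (A : Set Site) (S : Finset DEdge) : Prop where
  b : ∀ e ∈ S, bE A e
  n : ∀ e ∈ S, nxt A e ∈ S

lemma Loop.image {A : Set Site} {S : Finset DEdge} (h : Loop A S) : S.image (nxt A) = S := by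
  apply Finset.eq_of_subset_of_card_le
  · intro a ha
    obtain ⟨e, he, rfl⟩ := Finset.mem_image.1 ha
    exact h.n e he
  · rw [Finset.card_image_of_injOn]
    intro a ha b hb hab
    exact nxt_inj (h.b a ha) (h.b b hb) hab

lemma Loop.sum_phi {A : Set Site} {S : Finset DEdge} (h : Loop A S) (x : Site) :
    ∑ e ∈ S, phi x (endV e) = ∑ e ∈ S, phi x (staV e) := by
  conv_rhs => rw [← h.image]
  rw [Finset.sum_image]
  · simp [sta_nxt]
  · intro a ha b hb hab
    exact nxt_inj (h.b a ha) (h.b b hb) hab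

lemma cr_neg (x u : Site) (e : DEdge) : cr (x + u) (-u) e = - cr x u e := by
  simp [cr]

lemma Loop.grad {A : Set Site} {S : Finset DEdge} (h : Loop A S) (x u : Site) (hu : u ∈ dirs) :
    Wd S x - Wd S (x + u) = ∑ e ∈ S, cr x u e := by
  have H : ∀ x : Site, Wd S x - Wd S (x + (1,0)) = ∑ e ∈ S, cr x (1,0) e := by
    intro x
    rw [Wd, Wd, ← Finset.sum_sub_distrib]
    exact Finset.sum_congr rfl fun e he => contr_h x e (h.b e he).1
  have V : ∀ x : Site, Wd S x - Wd S (x + (0,1)) = ∑ e ∈ S, cr x (0,1) e := by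
    intro x
    rw [← Finset.sum_congr rfl fun e he => contr_v x e (h.b e he).1,
      Finset.sum_sub_distrib, Finset.sum_sub_distrib, Finset.sum_sub_distrib, h.sum_phi, Wd, Wd]
    ring
  have flip : ∀ v : Site, (∀ x : Site, Wd S x - Wd S (x + v) = ∑ e ∈ S, cr x v e) →
      Wd S x - Wd S (x + -v) = ∑ e ∈ S, cr x (-v) e := by
    intro v hv
    have h1 := hv (x + -v)
    have h2 : ∀ e, cr x (-v) e = - cr (x + -v) v e := by
      intro e
      have := cr_neg (x + -v) v e
      simpa using this
    simp only [h2, Finset.sum_neg_distrib, ← h1]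
    simp
  rw [mem_dirs] at hu
  rcases hu with rfl | rfl | rfl | rfl
  · exact H x
  · exact flip (1,0) H
  · exact V x
  · exact flip (0,1) V

lemma Loop.grad' {A : Set Site} {S : Finset DEdge} (h : Loop A S) (x u : Site) (hu : u ∈ dirs) :
    Wd S x - Wd S (x + u) = (if (x, u) ∈ S then 1 else 0) - (if (x + u, -u) ∈ S then 1 else 0) := by
  rw [h.grad x u hu]
  simp [cr, Finset.sum_sub_distrib]

/-- Vertical convexity: off-sites of `Λ` are connected to infinity by a vertical ray. -/
def VRay (Λ : Finset Site) : Prop :=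
  ∀ y : Site, y ∉ Λ → (∀ n : ℕ, y + (0, (n : ℤ)) ∉ Λ) ∨ (∀ n : ℕ, y + (0, -(n : ℤ)) ∉ Λ)

def Bd (Λ : Finset Site) (M : ℤ) : Prop :=
  ∀ x ∈ Λ, -M < x.1 ∧ x.1 < M ∧ -M < x.2 ∧ x.2 < M

lemma Wd_far {Λ : Finset Site} {M : ℤ} (hM : Bd Λ M) {S : Finset DEdge}
    (hS : ∀ e ∈ S, e.1 ∈ Λ) (x : Site) (hx : x.2 ≤ -M ∨ M ≤ x.2) : Wd S x = 0 := by
  apply Finset.sum_eq_zero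
  intro e he
  have := hM _ (hS e he)
  unfold contr
  rw [if_neg (by omega), if_neg (by omega)]

lemma Loop.const_step {A : Set Site} {S : Finset DEdge} (h : Loop A S) (x u : Site) (hu : u ∈ dirs)
    (hx : x ∈ A ↔ x + u ∈ A) : Wd S x = Wd S (x + u) := by
  have := h.grad' x u hu
  have h1 : (x, u) ∉ S := fun hh => by
    have := (h.b _ hh).2; simp only at this; tauto
  have h2 : (x + u, -u) ∉ S := fun hh => by
    have := (h.b _ hh).2; simp only [add_neg_cancel_right] at this; tauto
  simp only [h1, h2, if_false] at this
  omega

lemma Loop.zero_off {A : Set Site} {S : Finset DEdge} (h : Loop A S) {Λ : Finset Site} {M : ℤ}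
    (hA : ∀ x ∈ A, x ∈ Λ) (hM : Bd Λ M) (hΛ : VRay Λ) (y : Site) (hy : y ∉ Λ) : Wd S y = 0 := by
  have hS : ∀ e ∈ S, e.1 ∈ Λ := fun e he => hA _ (h.b e he).2.1
  rcases hΛ y hy with hr | hr
  · have key : ∀ n : ℕ, Wd S y = Wd S (y + (0, (n:ℤ))) := by
      intro n
      induction n with
      | zero => rw [show y + (0, ((0:ℕ):ℤ)) = y by ext <;> simp]
      | succ n ih =>
        have e1 : y + (0, ((n+1 : ℕ) : ℤ)) = y + (0, (n:ℤ)) + (0,1) := by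
          rw [add_assoc]; simp
        have h1 : y + (0, (n:ℤ)) ∉ A := fun hh => hr n (hA _ hh)
        have h2 : y + (0, (n:ℤ)) + (0,1) ∉ A := fun hh => hr (n+1) (by rw [e1]; exact hA _ hh)
        rw [ih, e1]
        exact h.const_step _ _ (by simp [mem_dirs]) (by tauto)
    rw [key (M - y.2).toNat]
    apply Wd_far hM hS
    right
    simp only [Prod.snd_add]
    have := Int.self_le_toNat (M - y.2)
    omega
  · have key : ∀ n : ℕ, Wd S y = Wd S (y + (0, -(n:ℤ))) := by
      intro n
      induction n with
      | zero => rw [show y + (0, -((0:ℕ):ℤ)) = y by ext <;> simp]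
      | succ n ih =>
        have e1 : y + (0, -((n+1 : ℕ) : ℤ)) = y + (0, -(n:ℤ)) + (0,-1) := by
          rw [add_assoc]; simp; ring
        have h1 : y + (0, -(n:ℤ)) ∉ A := fun hh => hr n (hA _ hh)
        have h2 : y + (0, -(n:ℤ)) + (0,-1) ∉ A := fun hh => hr (n+1) (by rw [e1]; exact hA _ hh)
        rw [ih, e1]
        exact h.const_step _ _ (by simp [mem_dirs]) (by tauto)
    rw [key (M + y.2).toNat]
    apply Wd_far hM hS
    left
    simp only [Prod.snd_add]
    have := Int.self_le_toNat (M + y.2)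
    omega

def allE (Λ : Finset Site) (A : Set Site) : Finset DEdge := (Λ ×ˢ dirs).filter (bE A)

lemma mem_allE {Λ : Finset Site} {A : Set Site} (hA : ∀ x ∈ A, x ∈ Λ) (e : DEdge) :
    e ∈ allE Λ A ↔ bE A e := by
  unfold allE
  rw [Finset.mem_filter, Finset.mem_product]
  refine ⟨fun h => h.2, fun h => ⟨⟨hA _ h.2.1, h.1⟩, h⟩⟩

lemma allE_loop {Λ : Finset Site} {A : Set Site} (hA : ∀ x ∈ A, x ∈ Λ) : Loop A (allE Λ A) :=
  ⟨fun e he => (mem_allE hA e).1 he, fun e he => (mem_allE hA _).2 (nxt_bE ((mem_allE hA e).1 he))⟩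

lemma allE_one {Λ : Finset Site} {A : Set Site} {M : ℤ} (hA : ∀ x ∈ A, x ∈ Λ) (hM : Bd Λ M)
    (x : Site) (hx : x ∈ A) : Wd (allE Λ A) x = 1 := by
  have hl := allE_loop hA
  have key : ∀ n : ℕ, Wd (allE Λ A) x - 1 =
      Wd (allE Λ A) (x + (0,(n:ℤ))) - (if x + (0,(n:ℤ)) ∈ A then 1 else 0) := by
    intro n
    induction n with
    | zero => rw [show x + (0, ((0:ℕ):ℤ)) = x by ext <;> simp, if_pos hx]
    | succ n ih =>
      have e1 : x + (0, ((n+1 : ℕ) : ℤ)) = x + (0, (n:ℤ)) + (0,1) := by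
        rw [add_assoc]; simp
      rw [ih, e1]
      have := hl.grad' (x + (0, (n:ℤ))) (0,1) (by simp [mem_dirs])
      simp only [mem_allE hA] at this
      have d1 : ((0,1):Site) ∈ dirs := by simp [mem_dirs]
      have d2 : (-(0,1):Site) ∈ dirs := neg_mem d1
      have b1 : bE A (x + (0, (n:ℤ)), (0,1)) ↔ x + (0, (n:ℤ)) ∈ A ∧ x + (0, (n:ℤ)) + (0,1) ∉ A := by
        simp only [bE, d1, true_and]
      have b2 : bE A (x + (0, (n:ℤ)) + (0,1), -(0,1)) ↔
          x + (0, (n:ℤ)) + (0,1) ∈ A ∧ x + (0, (n:ℤ)) ∉ A := by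
        simp only [bE, d2, true_and, add_neg_cancel_right]
      simp only [b1, b2] at this
      by_cases c1 : x + (0, (n:ℤ)) ∈ A <;> by_cases c2 : x + (0, (n:ℤ)) + (0,1) ∈ A <;>
        simp only [c1, c2, if_true, if_false, not_true, not_false_iff, and_true, and_false] at this ⊢ <;> omega
  have hk := key (M - x.2).toNat
  have hrow : M ≤ (x + (0, (((M - x.2).toNat : ℕ):ℤ))).2 := by
    simp only [Prod.snd_add]
    have := Int.self_le_toNat (M - x.2)
    omega
  have hnot : x + (0, (((M - x.2).toNat : ℕ):ℤ)) ∉ A := fun hh => by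
    have := hM _ (hA _ hh); omega
  rw [if_neg hnot, Wd_far hM (fun e he => hA _ (hl.b e he).2.1) _ (Or.inr hrow)] at hk
  omega

/-- A single loop winding positively around `x`. -/
lemma exists_orbit {Λ : Finset Site} {A : Set Site} {M : ℤ} (hA : ∀ x ∈ A, x ∈ Λ) (hM : Bd Λ M)
    (x : Site) (hx : x ∈ A) : ∃ S : Finset DEdge, Loop A S ∧ 1 ≤ Wd S x ∧
      ∀ e ∈ S, ∃ m : ℕ, Set.InjOn (fun i => (nxt A)^[i] e) (Finset.range m : Finset ℕ) ∧
        S = (Finset.range m).image (fun i => (nxt A)^[i] e) := by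
  have hex : ∃ n : ℕ, ∃ S : Finset DEdge, S.card = n ∧ Loop A S ∧ 1 ≤ Wd S x :=
    ⟨_, allE Λ A, rfl, allE_loop hA, (allE_one hA hM x hx).ge⟩
  obtain ⟨S, hc, hl, hw⟩ := Nat.find_spec hex
  have hmin : ∀ T : Finset DEdge, T.card < S.card → Loop A T → ¬ 1 ≤ Wd T x := by
    intro T hT hlT hwT
    rw [hc] at hT
    exact Nat.find_min hex hT ⟨T, rfl, hlT, hwT⟩
  refine ⟨S, hl, hw, fun e he => ?_⟩
  obtain ⟨m, hm, hi, hsub, hcl, hcl2⟩ := orbit_aux (nxt A) S hl.n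
    (fun a ha b hb h => nxt_inj (hl.b a ha) (hl.b b hb) h) e he
  refine ⟨m, hi, ?_⟩
  set T := (Finset.range m).image (fun i => (nxt A)^[i] e) with hT
  by_contra hne
  have hTl : Loop A T := ⟨fun a ha => hl.b a (hsub ha), hcl⟩
  have hDl : Loop A (S \ T) := ⟨fun a ha => hl.b a (Finset.mem_sdiff.1 ha).1, hcl2⟩
  have h1 : T.card < S.card := Finset.card_lt_card (hsub.ssubset_of_ne (Ne.symm hne))
  have heT : e ∈ T := Finset.mem_image.2 ⟨0, Finset.mem_range.2 hm, rfl⟩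
  have h2 : (S \ T).card < S.card := by
    apply Finset.card_lt_card
    refine (Finset.sdiff_subset).ssubset_of_ne fun hh => ?_
    rw [← hh] at he
    exact (Finset.mem_sdiff.1 he).2 heT
  have h3 := hmin T h1 hTl
  have h4 := hmin (S \ T) h2 hDl
  have h5 : Wd (S \ T) x + Wd T x = Wd S x := Finset.sum_sdiff hsub
  omega

def path : DEdge → List (Fin 3) → List DEdge
  | _, [] => []
  | e, t :: ts => e :: path (move e t) ts

def turns (A : Set Site) : DEdge → ℕ → List (Fin 3)
  | _, 0 => []
  | e, n + 1 => turn A e :: turns A (nxt A e) n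

lemma turns_length (A : Set Site) (n : ℕ) : ∀ e, (turns A e n).length = n := by
  induction n with
  | zero => intro e; rfl
  | succ n ih => intro e; simp [turns, ih]

lemma path_turns (A : Set Site) (y : Site) (n : ℕ) : ∀ e,
    ((path e (turns A e n)).map (contr y)).sum = ∑ i ∈ Finset.range n, contr y ((nxt A)^[i] e) := by
  induction n with
  | zero => intro e; simp [turns, path]
  | succ n ih =>
    intro e
    rw [Finset.sum_range_succ']
    simp only [turns, path, List.map_cons, List.sum_cons, Function.iterate_succ_apply,
      Function.iterate_zero, id]
    have : move e (turn A e) = nxt A e := rfl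
    rw [this, ih, add_comm]

def cw (x : Site) (k : ℕ) (t : List (Fin 3)) (y : Site) : ℤ :=
  ((path (x + ((k:ℤ), 0), (1, 0)) t).map (contr y)).sum

lemma abs_peel {p q : ℤ} : |(p)| = |p - q| + |q| ↔ (0 ≤ q ∧ q ≤ p) ∨ (p ≤ q ∧ q ≤ 0) := by
  constructor
  · intro h
    rcases abs_cases p with h1 | h1 <;> rcases abs_cases (p-q) with h2 | h2 <;>
      rcases abs_cases q with h3 | h3 <;> omega
  · intro h
    rcases abs_cases p with h1 | h1 <;> rcases abs_cases (p-q) with h2 | h2 <;>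
      rcases abs_cases q with h3 | h3 <;> omega

def Peel (Λ : Finset Site) (η w : Config) : Prop :=
  (∀ y, y ∉ Λ → w y = 0) ∧
  ∀ y u, u ∈ dirs → |η y - η (y+u)| = |(η y - w y) - (η (y+u) - w (y+u))| + |w y - w (y+u)|

/-- Master contour lemma. -/
lemma contour {Λ : Finset Site} {M : ℤ} (hM : Bd Λ M) (hΛ : VRay Λ) (η : Config)
    (hη : ∀ y, y ∉ Λ → η y = 0) (x : Site) (hx : 1 ≤ η x) :
    ∃ (k : ℕ) (t : List (Fin 3)), Peel Λ η (cw x k t) ∧ 1 ≤ cw x k t x ∧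
      (∀ u ∈ dirs, 1 ≤ η (x + u) → cw x k t (x + u) = cw x k t x) ∧
      (∀ i : ℕ, i ≤ k → 1 ≤ cw x k t (x + ((i:ℤ), 0))) ∧
      ∃ S : Finset DEdge, S.card = t.length ∧ ∀ e ∈ S, e.1 ∈ Λ ∧ e.2 ∈ dirs ∧
        cw x k t e.1 - cw x k t (e.1 + e.2) = 1 := by
  set A : Set Site := {y | 1 ≤ η y} with hAdef
  have hA : ∀ y ∈ A, y ∈ Λ := by
    intro y hy
    by_contra h
    have := hη y h
    simp only [hAdef, Set.mem_ofPred_eq] at hy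
    omega
  obtain ⟨S, hl, hw, horb⟩ := exists_orbit hA hM x hx
  -- choose k
  have hexk : ∃ k : ℕ, Wd S (x + (((k+1:ℕ):ℤ), 0)) ≤ 0 := by
    refine ⟨(M - x.1).toNat, ?_⟩
    rw [hl.zero_off hA hM hΛ]
    intro hh
    have := hM _ hh
    have h2 := Int.self_le_toNat (M - x.1)
    simp only [Prod.fst_add] at this
    push_cast at this
    omega
  set k := Nat.find hexk with hk
  have hk1 : Wd S (x + (((k+1:ℕ):ℤ), 0)) ≤ 0 := Nat.find_spec hexk
  have hk2 : ∀ i : ℕ, i ≤ k → 1 ≤ Wd S (x + ((i:ℤ), 0)) := by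
    intro i hi
    rcases i with _ | i
    · have : x + (((0:ℕ):ℤ), (0:ℤ)) = x := by simp
      rw [this]; exact hw
    · have := Nat.find_min hexk (m := i) (by omega)
      omega
  have he0 : (x + ((k:ℤ), 0), ((1,0):Site)) ∈ S := by
    have g := hl.grad' (x + ((k:ℤ), 0)) (1,0) (by simp [mem_dirs])
    have e1 : x + (((k+1:ℕ):ℤ), 0) = x + ((k:ℤ), 0) + (1,0) := by rw [add_assoc]; simp
    rw [e1] at hk1
    have := hk2 k le_rfl
    by_contra hh
    rw [if_neg hh] at g
    split_ifs at g <;> omega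
  obtain ⟨m, hinj, hSe⟩ := horb _ he0
  have hcw : ∀ y, cw x k (turns A (x + ((k:ℤ), 0), ((1,0):Site)) m) y = Wd S y := by
    intro y
    rw [cw, path_turns, Wd]
    conv_rhs => rw [hSe]
    rw [Finset.sum_image hinj]
  refine ⟨k, turns A (x + ((k:ℤ), 0), ((1,0):Site)) m, ?_⟩
  have hfun : cw x k (turns A (x + ((k:ℤ), 0), ((1,0):Site)) m) = Wd S := funext hcw
  rw [hfun]
  refine ⟨⟨hl.zero_off hA hM hΛ, ?_⟩, hw, ?_, hk2, S, ?_, ?_⟩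
  · intro y u hu
    have g := hl.grad' y u hu
    have e1 : (η y - Wd S y) - (η (y+u) - Wd S (y+u)) =
      (η y - η (y+u)) - (Wd S y - Wd S (y+u)) := by ring
    rw [e1, abs_peel]
    by_cases c1 : (y, u) ∈ S
    · have b1 := (hl.b _ c1).2
      have c2 : (y + u, -u) ∉ S := fun hh => by
        have b2 := (hl.b _ hh).2
        exact b1.2 b2.1
      rw [if_pos c1, if_neg c2] at g
      simp only [hAdef, Set.mem_ofPred_eq] at b1
      omega
    · by_cases c2 : (y + u, -u) ∈ S
      · have b2 := (hl.b _ c2).2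
        rw [if_neg c1, if_pos c2] at g
        simp only [hAdef, Set.mem_ofPred_eq, add_neg_cancel_right] at b2
        omega
      · rw [if_neg c1, if_neg c2] at g
        omega
  · intro u hu hxu
    exact (hl.const_step x u hu (by simp only [hAdef, Set.mem_ofPred_eq]; tauto)).symm
  · rw [turns_length, hSe, Finset.card_image_of_injOn hinj, Finset.card_range]
  · intro e he
    have b := hl.b e he
    refine ⟨hA _ b.2.1, b.1, ?_⟩
    rw [hl.grad' e.1 e.2 b.1, if_pos (by exact he), if_neg]
    · simp
    · intro hh
      exact b.2.2 (hl.b _ hh).2.1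



def bigB (M : ℤ) : Finset Site := Finset.Icc (-M) M ×ˢ Finset.Icc (-M) M

def pdir (M : ℤ) (w : Config) (u : Site) : ℤ := ∑ x ∈ bigB M, max (w x - w (x + u)) 0

def pp (M : ℤ) (w : Config) : ℤ := ∑ u ∈ dirs, pdir M w u

lemma pp_eq (M : ℤ) (w : Config) :
    pp M w = pdir M w (1,0) + pdir M w (-1,0) + pdir M w (0,1) + pdir M w (0,-1) := by
  unfold pp dirs
  rw [Finset.sum_insert, Finset.sum_insert, Finset.sum_insert, Finset.sum_singleton]
  · ring
  all_goals simp

lemma pdir_nonneg (M : ℤ) (w : Config) (u : Site) : 0 ≤ pdir M w u :=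
  Finset.sum_nonneg fun _ _ => le_max_right _ _

lemma nbrs_eq (x : Site) : nbrs x = dirs.image (fun u => x + u) := by
  ext y
  obtain ⟨x1, x2⟩ := x
  obtain ⟨y1, y2⟩ := y
  simp only [nbrs, dirs, Finset.mem_insert, Finset.mem_singleton, Finset.mem_image, exists_eq_or_imp,
    exists_eq_left, Prod.mk_add_mk, Prod.mk.injEq]
  omega

lemma sum_nbrs {β : Type*} [AddCommMonoid β] (x : Site) (F : Site → β) :
    ∑ u ∈ dirs, F (x + u) = ∑ y ∈ nbrs x, F y := by
  rw [nbrs_eq, Finset.sum_image]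
  intro a _ b _ h
  simpa using h

lemma mem_nbrs {x y : Site} : y ∈ nbrs x ↔ ∃ u ∈ dirs, y = x + u := by
  rw [nbrs_eq, Finset.mem_image]
  constructor
  · rintro ⟨u, h, rfl⟩; exact ⟨u, h, rfl⟩
  · rintro ⟨u, h, rfl⟩; exact ⟨u, h, rfl⟩

lemma nbrs_symm {x y : Site} : y ∈ nbrs x ↔ x ∈ nbrs y := by
  have : ∀ x y : Site, y ∈ nbrs x → x ∈ nbrs y := by
    intro x y h
    obtain ⟨u, hu, rfl⟩ := mem_nbrs.1 h
    exact mem_nbrs.2 ⟨-u, neg_mem hu, by simp⟩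
  exact ⟨this x y, this y x⟩

lemma energy {Λ : Finset Site} {M : ℤ} (hM : Bd Λ M) (η : Config)
    (hη : ∀ y, y ∉ Λ → η y = 0) : sosH Λ 0 η = (pp M η : ℝ) := by
  set f : Site → Site → ℤ := fun x y => max (η x - η y) 0 with hf
  have habs : ∀ x y, |η x - η y| = f x y + f y x := by
    intro x y
    simp only [hf]
    rcases abs_cases (η x - η y) with h | h <;> omega
  have hsub : Λ ⊆ bigB M := by
    intro x hx
    have := hM x hx
    simp only [bigB, Finset.mem_product, Finset.mem_Icc]
    omega
  have hpp : pp M η = ∑ x ∈ bigB M, ∑ y ∈ nbrs x, f x y := by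
    unfold pp pdir
    rw [Finset.sum_comm]
    refine Finset.sum_congr rfl fun x _ => ?_
    exact sum_nbrs x (fun y => f x y)
  have hsplit : ∀ x, ∑ y ∈ nbrs x, f x y =
      ∑ y ∈ (nbrs x).filter (fun y => y ∈ Λ), f x y + ∑ y ∈ (nbrs x).filter (fun y => y ∉ Λ), f x y := by
    intro x
    rw [Finset.sum_filter_add_sum_filter_not]
  have hout : ∑ x ∈ bigB M \ Λ, ∑ y ∈ nbrs x, f x y =
      ∑ x ∈ Λ, ∑ y ∈ (nbrs x).filter (fun y => y ∉ Λ), f y x := by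
    have : ∀ x ∈ bigB M \ Λ, ∑ y ∈ nbrs x, f x y = ∑ y ∈ (nbrs x).filter (fun y => y ∈ Λ), f x y := by
      intro x hx
      rw [hsplit]
      rw [Finset.sum_eq_zero (s := (nbrs x).filter (fun y => y ∉ Λ)), add_zero]
      intro y hy
      simp only [hf]
      rw [hη x (Finset.mem_sdiff.1 hx).2, hη y (Finset.mem_filter.1 hy).2]; simp
    rw [Finset.sum_congr rfl this]
    apply Finset.sum_comm'
    intro x y
    simp only [Finset.mem_sdiff, Finset.mem_filter]
    constructor
    · rintro ⟨⟨a, b⟩, c, d⟩; exact ⟨⟨nbrs_symm.1 c, b⟩, d⟩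
    · rintro ⟨⟨a, b⟩, c⟩
      refine ⟨⟨?_, b⟩, nbrs_symm.1 a, c⟩
      obtain ⟨u, hu, rfl⟩ := mem_nbrs.1 a
      have := hM y c
      rw [mem_dirs] at hu
      simp only [bigB, Finset.mem_product, Finset.mem_Icc, Prod.fst_add, Prod.snd_add]
      rcases hu with rfl | rfl | rfl | rfl <;> simp only <;> omega
  have hswap : ∑ x ∈ Λ, ∑ y ∈ (nbrs x).filter (fun y => y ∈ Λ), f x y =
      ∑ x ∈ Λ, ∑ y ∈ (nbrs x).filter (fun y => y ∈ Λ), f y x := by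
    apply Finset.sum_comm'
    intro x y
    simp only [Finset.mem_filter]
    rw [nbrs_symm]; tauto
  have h1 : ∑ x ∈ Λ, ∑ y ∈ (nbrs x).filter (fun y => y ∈ Λ), |η x - η y| =
      2 * ∑ x ∈ Λ, ∑ y ∈ (nbrs x).filter (fun y => y ∈ Λ), f x y := by
    simp only [habs, Finset.sum_add_distrib]
    rw [← hswap]; ring
  have h2 : ∑ x ∈ Λ, ∑ y ∈ (nbrs x).filter (fun y => y ∉ Λ), |η x - (0 : Config) y| =
      ∑ x ∈ Λ, ∑ y ∈ (nbrs x).filter (fun y => y ∉ Λ), f x y +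
      ∑ x ∈ Λ, ∑ y ∈ (nbrs x).filter (fun y => y ∉ Λ), f y x := by
    rw [← Finset.sum_add_distrib]
    refine Finset.sum_congr rfl fun x _ => ?_
    rw [← Finset.sum_add_distrib]
    refine Finset.sum_congr rfl fun y hy => ?_
    rw [← habs, hη y (Finset.mem_filter.1 hy).2]; rfl
  have h3 : pp M η = ∑ x ∈ Λ, ∑ y ∈ (nbrs x).filter (fun y => y ∈ Λ), f x y +
      ∑ x ∈ Λ, ∑ y ∈ (nbrs x).filter (fun y => y ∉ Λ), |η x - (0 : Config) y| := by
    rw [hpp, ← Finset.sum_sdiff hsub, hout, h2]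
    simp only [hsplit, Finset.sum_add_distrib]
    ring
  unfold sosH
  have h1' := congrArg (Int.cast : ℤ → ℝ) h1
  have h3' := congrArg (Int.cast : ℤ → ℝ) h3
  push_cast at h1' h3' ⊢
  rw [h3', h1']
  ring

lemma peel_energy {Λ : Finset Site} (η w : Config) (hη : ∀ y, y ∉ Λ → η y = 0) (hp : Peel Λ η w) :
    sosH Λ 0 η = sosH Λ 0 (η - w) + sosH Λ 0 w := by
  have key : ∀ x y, y ∈ nbrs x → ((|η x - η y| : ℤ) : ℝ) =
      ((|(η - w) x - (η - w) y| : ℤ) : ℝ) + ((|w x - w y| : ℤ) : ℝ) := by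
    intro x y h
    obtain ⟨u, hu, rfl⟩ := mem_nbrs.1 h
    have := hp.2 x u hu
    rw [this]; push_cast; simp
  unfold sosH
  have h1 : ∑ x ∈ Λ, ∑ y ∈ (nbrs x).filter (fun y => y ∈ Λ), ((|η x - η y| : ℤ) : ℝ) =
     ∑ x ∈ Λ, ∑ y ∈ (nbrs x).filter (fun y => y ∈ Λ), ((|(η - w) x - (η - w) y| : ℤ) : ℝ) +
     ∑ x ∈ Λ, ∑ y ∈ (nbrs x).filter (fun y => y ∈ Λ), ((|w x - w y| : ℤ) : ℝ) := by
    simp only [← Finset.sum_add_distrib]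
    exact Finset.sum_congr rfl fun x _ => Finset.sum_congr rfl fun y hy =>
      key x y (Finset.mem_filter.1 hy).1
  have h2 : ∑ x ∈ Λ, ∑ y ∈ (nbrs x).filter (fun y => y ∉ Λ), ((|η x - (0:Config) y| : ℤ) : ℝ) =
     ∑ x ∈ Λ, ∑ y ∈ (nbrs x).filter (fun y => y ∉ Λ), ((|(η - w) x - (0:Config) y| : ℤ) : ℝ) +
     ∑ x ∈ Λ, ∑ y ∈ (nbrs x).filter (fun y => y ∉ Λ), ((|w x - (0:Config) y| : ℤ) : ℝ) := by
    simp only [← Finset.sum_add_distrib]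
    refine Finset.sum_congr rfl fun x _ => Finset.sum_congr rfl fun y hy => ?_
    have := key x y (Finset.mem_filter.1 hy).1
    have hy' := (Finset.mem_filter.1 hy).2
    rw [Pi.sub_apply, Pi.sub_apply, hη y hy', hp.1 y hy'] at this
    simpa using this
  rw [h1, h2]; ring

lemma ray_up (M : ℤ) (v : ℤ → ℤ) (hv : ∀ n, M ≤ n → v n = 0) (n : ℤ) (hn : -M ≤ n) :
    max (v n) 0 ≤ ∑ r ∈ Finset.Icc (-M) M, max (v r - v (r+1)) 0 := by
  have key : ∀ k : ℕ, ∀ n : ℤ, M - k ≤ n → v n ≤ ∑ r ∈ Finset.Icc n M, max (v r - v (r+1)) 0 := by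
    intro k
    induction k with
    | zero =>
      intro n hn
      rw [hv n (by simpa using hn)]
      exact Finset.sum_nonneg fun _ _ => le_max_right _ _
    | succ k ih =>
      intro n hn
      by_cases h : M ≤ n
      · rw [hv n h]
        exact Finset.sum_nonneg fun _ _ => le_max_right _ _
      · have e : Finset.Icc n M = insert n (Finset.Icc (n+1) M) := by
          ext r; simp only [Finset.mem_insert, Finset.mem_Icc]; omega
        rw [e, Finset.sum_insert (by simp)]
        have := ih (n+1) (by push_cast at hn; omega)
        have h2 := le_max_left (v n - v (n+1)) 0
        omega
  apply max_le
  · refine (key (M - n).toNat n (by have := Int.self_le_toNat (M - n); omega)).trans ?_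
    apply Finset.sum_le_sum_of_subset_of_nonneg
    · exact Finset.Icc_subset_Icc hn le_rfl
    · intro _ _ _; exact le_max_right _ _
  · exact Finset.sum_nonneg fun _ _ => le_max_right _ _

lemma ray_dn (M : ℤ) (v : ℤ → ℤ) (hv : ∀ n, n ≤ -M → v n = 0) (n : ℤ) (hn : n ≤ M) :
    max (v n) 0 ≤ ∑ r ∈ Finset.Icc (-M) M, max (v r - v (r + -1)) 0 := by
  have h := ray_up M (fun r => v (-r)) (fun r hr => hv _ (by omega)) (-n) (by omega)
  simp only [neg_neg] at h
  refine h.trans (le_of_eq ?_)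
  have e : Finset.Icc (-M) M = (Finset.Icc (-M) M).image (fun r => -r) := by
    ext r
    simp only [Finset.mem_image, Finset.mem_Icc]
    constructor
    · intro h; exact ⟨-r, by omega, by omega⟩
    · rintro ⟨a, h, rfl⟩; omega
  conv_rhs => rw [e]
  rw [Finset.sum_image (fun a _ b _ hab => neg_injective hab)]
  refine Finset.sum_congr rfl fun r _ => ?_
  rw [neg_add]

lemma sum_inj_le (M : ℤ) (R : Finset Site) (p : Site → ℤ) (hinj : Set.InjOn p (R : Set Site))
    (F : Site → ℤ) (Gs : ℤ → ℤ) (hG : ∀ r, 0 ≤ Gs r)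
    (h1 : ∀ x ∈ R, p x ∈ Finset.Icc (-M) M → F x ≤ Gs (p x))
    (h2 : ∀ x ∈ R, p x ∉ Finset.Icc (-M) M → F x ≤ 0) :
    ∑ x ∈ R, F x ≤ ∑ r ∈ Finset.Icc (-M) M, Gs r := by
  rw [← Finset.sum_filter_add_sum_filter_not R (fun x => p x ∈ Finset.Icc (-M) M)]
  have a2 : ∑ x ∈ R.filter (fun x => ¬ p x ∈ Finset.Icc (-M) M), F x ≤ 0 :=
    Finset.sum_nonpos fun x hx => h2 x (Finset.mem_filter.1 hx).1 (Finset.mem_filter.1 hx).2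
  have a1 : ∑ x ∈ R.filter (fun x => p x ∈ Finset.Icc (-M) M), F x ≤
      ∑ r ∈ Finset.Icc (-M) M, Gs r := by
    calc _ ≤ ∑ x ∈ R.filter (fun x => p x ∈ Finset.Icc (-M) M), Gs (p x) :=
          Finset.sum_le_sum fun x hx => h1 x (Finset.mem_filter.1 hx).1 (Finset.mem_filter.1 hx).2
      _ = ∑ r ∈ (R.filter (fun x => p x ∈ Finset.Icc (-M) M)).image p, Gs r := by
          rw [Finset.sum_image]
          intro a ha b hb
          exact hinj (Finset.mem_filter.1 ha).1 (Finset.mem_filter.1 hb).1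
      _ ≤ _ := by
          apply Finset.sum_le_sum_of_subset_of_nonneg
          · intro r hr
            obtain ⟨x, hx, rfl⟩ := Finset.mem_image.1 hr
            exact (Finset.mem_filter.1 hx).2
          · intro _ _ _; exact hG _
  omega

lemma dir_rows {Λ : Finset Site} {M : ℤ} (hM : Bd Λ M) (w : Config) (hw : ∀ y, y ∉ Λ → w y = 0)
    (R : Finset Site) (hR : Set.InjOn Prod.snd (R : Set Site)) :
    ∑ x ∈ R, max (w x) 0 ≤ pdir M w (1,0) ∧ ∑ x ∈ R, max (w x) 0 ≤ pdir M w (-1,0) := by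
  have hz : ∀ y : Site, (y.1 ≤ -M ∨ M ≤ y.1 ∨ y.2 ≤ -M ∨ M ≤ y.2) → w y = 0 := fun y hy =>
    hw y fun hh => by have := hM y hh; omega
  constructor
  · rw [pdir, bigB, Finset.sum_product_right]
    apply sum_inj_le M R Prod.snd hR
    · intro r; exact Finset.sum_nonneg fun _ _ => le_max_right _ _
    · intro x _ hx
      by_cases hb : -M ≤ x.1
      · have := ray_up M (fun n => w (n, x.2)) (fun n hn => hz _ (by simp only; omega)) x.1 hb
        simpa using this
      · rw [hz x (by omega)]; simp only [max_self]
        exact Finset.sum_nonneg fun _ _ => le_max_right _ _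
    · intro x _ hx
      rw [Finset.mem_Icc] at hx
      rw [hz x (by omega)]; simp
  · rw [pdir, bigB, Finset.sum_product_right]
    apply sum_inj_le M R Prod.snd hR
    · intro r; exact Finset.sum_nonneg fun _ _ => le_max_right _ _
    · intro x _ hx
      by_cases hb : x.1 ≤ M
      · have := ray_dn M (fun n => w (n, x.2)) (fun n hn => hz _ (by simp only; omega)) x.1 hb
        simpa using this
      · rw [hz x (by omega)]; simp only [max_self]
        exact Finset.sum_nonneg fun _ _ => le_max_right _ _
    · intro x _ hx
      rw [Finset.mem_Icc] at hx
      rw [hz x (by omega)]; simp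

lemma dir_cols {Λ : Finset Site} {M : ℤ} (hM : Bd Λ M) (w : Config) (hw : ∀ y, y ∉ Λ → w y = 0)
    (R : Finset Site) (hR : Set.InjOn Prod.fst (R : Set Site)) :
    ∑ x ∈ R, max (w x) 0 ≤ pdir M w (0,1) ∧ ∑ x ∈ R, max (w x) 0 ≤ pdir M w (0,-1) := by
  have hz : ∀ y : Site, (y.1 ≤ -M ∨ M ≤ y.1 ∨ y.2 ≤ -M ∨ M ≤ y.2) → w y = 0 := fun y hy =>
    hw y fun hh => by have := hM y hh; omega
  constructor
  · rw [pdir, bigB, Finset.sum_product]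
    apply sum_inj_le M R Prod.fst hR
    · intro r; exact Finset.sum_nonneg fun _ _ => le_max_right _ _
    · intro x _ hx
      by_cases hb : -M ≤ x.2
      · have := ray_up M (fun n => w (x.1, n)) (fun n hn => hz _ (by simp only; omega)) x.2 hb
        simpa using this
      · rw [hz x (by omega)]; simp only [max_self]
        exact Finset.sum_nonneg fun _ _ => le_max_right _ _
    · intro x _ hx
      rw [Finset.mem_Icc] at hx
      rw [hz x (by omega)]; simp
  · rw [pdir, bigB, Finset.sum_product]
    apply sum_inj_le M R Prod.fst hR
    · intro r; exact Finset.sum_nonneg fun _ _ => le_max_right _ _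
    · intro x _ hx
      by_cases hb : x.2 ≤ M
      · have := ray_dn M (fun n => w (x.1, n)) (fun n hn => hz _ (by simp only; omega)) x.2 hb
        simpa using this
      · rw [hz x (by omega)]; simp only [max_self]
        exact Finset.sum_nonneg fun _ _ => le_max_right _ _
    · intro x _ hx
      rw [Finset.mem_Icc] at hx
      rw [hz x (by omega)]; simp

lemma pp_rows {Λ : Finset Site} {M : ℤ} (hM : Bd Λ M) (w : Config) (hw : ∀ y, y ∉ Λ → w y = 0)
    (R : Finset Site) (hR : Set.InjOn Prod.snd (R : Set Site)) : ∑ x ∈ R, max (w x) 0 ≤ pp M w := by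
  have := (dir_rows hM w hw R hR).1
  have h1 := pdir_nonneg M w (-1,0)
  have h2 := pdir_nonneg M w (0,1)
  have h3 := pdir_nonneg M w (0,-1)
  rw [pp_eq]; omega

lemma pp_four {Λ : Finset Site} {M : ℤ} (hM : Bd Λ M) (w : Config) (hw : ∀ y, y ∉ Λ → w y = 0)
    (x : Site) : 4 * w x ≤ pp M w := by
  have h1 := dir_rows hM w hw {x} (by simp)
  have h2 := dir_cols hM w hw {x} (by simp)
  simp only [Finset.sum_singleton] at h1 h2
  have := le_max_left (w x) 0
  rw [pp_eq]; omega

lemma pp_six {Λ : Finset Site} {M : ℤ} (hM : Bd Λ M) (w : Config) (hw : ∀ y, y ∉ Λ → w y = 0)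
    (x u : Site) (hu : u ∈ dirs) (hxu : w (x + u) = w x) : 6 * w x ≤ pp M w := by
  have h1 := dir_rows hM w hw {x} (by simp)
  have h2 := dir_cols hM w hw {x} (by simp)
  simp only [Finset.sum_singleton] at h1 h2
  have h0 := le_max_left (w x) 0
  have hne : x ≠ x + u := by
    rw [mem_dirs] at hu
    rcases hu with rfl | rfl | rfl | rfl <;> simp
  rw [pp_eq]
  have hs : ∑ y ∈ ({x, x + u} : Finset Site), max (w y) 0 = 2 * max (w x) 0 := by
    rw [Finset.sum_pair hne, hxu]; ring
  rw [mem_dirs] at hu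
  have hh : (u.1 ≠ 0) ∨ (u.2 ≠ 0) := by
    rcases hu with rfl | rfl | rfl | rfl <;> simp
  rcases hh with hh | hh
  · have h3 := dir_cols hM w hw {x, x + u} (by
      intro a ha b hb hab
      simp only [Finset.coe_insert, Finset.coe_singleton, Set.mem_insert_iff,
        Set.mem_singleton_iff] at ha hb
      have e1 : (x + u).fst = x.1 + u.1 := rfl
      rcases ha with ha | ha <;> rcases hb with hb | hb <;> subst ha <;> rw [hb] at hab ⊢ <;>
        exact absurd hab (by omega))
    rw [hs] at h3
    omega
  · have h3 := dir_rows hM w hw {x, x + u} (by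
      intro a ha b hb hab
      simp only [Finset.coe_insert, Finset.coe_singleton, Set.mem_insert_iff,
        Set.mem_singleton_iff] at ha hb
      have e1 : (x + u).snd = x.snd + u.2 := rfl
      rcases ha with ha | ha <;> rcases hb with hb | hb <;> subst ha <;> rw [hb] at hab ⊢ <;>
        exact absurd hab (by omega))
    rw [hs] at h3
    omega

lemma pp_k {Λ : Finset Site} {M : ℤ} (hM : Bd Λ M) (w : Config) (hw : ∀ y, y ∉ Λ → w y = 0)
    (x : Site) (k : ℕ) (hk : ∀ i : ℕ, i ≤ k → 1 ≤ w (x + ((i:ℤ), 0))) : (k:ℤ) + 1 ≤ pp M w := by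
  have hinj : Function.Injective (fun i : ℕ => x + ((i:ℤ), (0:ℤ))) := by
    intro i j hij
    simpa using hij
  have h := (dir_cols hM w hw ((Finset.range (k+1)).image (fun i : ℕ => x + ((i:ℤ), (0:ℤ)))) (by
    intro a ha b hb hab
    simp only [Finset.coe_image, Set.mem_image] at ha hb
    obtain ⟨i, _, rfl⟩ := ha
    obtain ⟨j, _, rfl⟩ := hb
    simpa using hab)).1
  rw [Finset.sum_image (fun a _ b _ hab => hinj hab)] at h
  have h2 : ∑ i ∈ Finset.range (k+1), (1:ℤ) ≤
      ∑ i ∈ Finset.range (k+1), max (w (x + ((i:ℤ), (0:ℤ)))) 0 := by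
    apply Finset.sum_le_sum
    intro i hi
    rw [Finset.mem_range] at hi
    exact le_max_of_le_left (hk i (by omega))
  simp at h2
  have a1 := pdir_nonneg M w (-1,0)
  have a2 := pdir_nonneg M w (1,0)
  have a3 := pdir_nonneg M w (0,-1)
  rw [pp_eq]; omega

lemma pp_card {Λ : Finset Site} {M : ℤ} (hM : Bd Λ M) (w : Config) (S : Finset DEdge)
    (hS : ∀ e ∈ S, e.1 ∈ Λ ∧ e.2 ∈ dirs ∧ w e.1 - w (e.1 + e.2) = 1) : (S.card : ℤ) ≤ pp M w := by
  have e1 : pp M w = ∑ e ∈ bigB M ×ˢ dirs, max (w e.1 - w (e.1 + e.2)) 0 := by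
    rw [Finset.sum_product_right]; rfl
  rw [e1]
  calc (S.card : ℤ) = ∑ e ∈ S, 1 := by simp
    _ ≤ ∑ e ∈ S, max (w e.1 - w (e.1 + e.2)) 0 := by
        apply Finset.sum_le_sum
        intro e he
        rw [(hS e he).2.2]; simp
    _ ≤ _ := by
        apply Finset.sum_le_sum_of_subset_of_nonneg
        · intro e he
          have h := hS e he
          have hb := hM _ h.1
          simp only [bigB, Finset.mem_product, Finset.mem_Icc]
          refine ⟨by omega, h.2.1⟩
        · intro _ _ _; exact le_max_right _ _



lemma list_sum (q : ENNReal) (hq : q ≤ 1/6) : ∑' t : List (Fin 3), q ^ t.length ≤ 2 := by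
  rw [← (Equiv.sigmaFiberEquiv (List.length : List (Fin 3) → ℕ)).tsum_eq, ENNReal.tsum_sigma']
  have h : ∀ n : ℕ, ∑' t : {t : List (Fin 3) // t.length = n},
      q ^ ((Equiv.sigmaFiberEquiv (List.length : List (Fin 3) → ℕ)) ⟨n, t⟩).length = (3 * q) ^ n := by
    intro n
    have e : ∀ t : {t : List (Fin 3) // t.length = n},
      q ^ ((Equiv.sigmaFiberEquiv (List.length : List (Fin 3) → ℕ)) ⟨n, t⟩).length = q ^ n := by
      intro t
      simp [Equiv.sigmaFiberEquiv, t.2]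
    simp only [e]
    have hc : Fintype.card (List.Vector (Fin 3) n) = 3 ^ n := by simp
    have : ∑' t : List.Vector (Fin 3) n, q ^ n = (3 * q) ^ n := by
      rw [tsum_fintype, Finset.sum_const, Finset.card_univ, hc, mul_pow]
      simp
    exact this
  simp only [h]
  rw [ENNReal.tsum_geometric]
  have h3 : 3 * q ≤ 1/2 := by
    calc 3 * q ≤ 3 * (1/6) := by gcongr
      _ = 1/2 := by
        rw [← ENNReal.toReal_eq_toReal_iff' (by simp [ENNReal.mul_eq_top]) (by simp)]
        simp; norm_num
  rw [ENNReal.inv_le_iff_inv_le]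
  calc (2:ENNReal)⁻¹ = 1 - 1/2 := by simp
    _ ≤ _ := by gcongr

lemma nat_sum (q : ENNReal) (hq : q ≤ 1/6) : ∑' k : ℕ, q ^ (k+1) ≤ 1/2 := by
  simp only [pow_succ]
  rw [ENNReal.tsum_mul_right, ENNReal.tsum_geometric]
  have h1 : (1 - q)⁻¹ ≤ 2 := by
    rw [ENNReal.inv_le_iff_inv_le]
    calc (2:ENNReal)⁻¹ = 1 - 1/2 := by simp
      _ ≤ 1 - 1/6 := by
        gcongr; norm_num
      _ ≤ _ := by gcongr
  calc (1-q)⁻¹ * q ≤ 2 * (1/6) := by gcongr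
    _ ≤ 1/2 := by
      rw [← ENNReal.toReal_le_toReal (by simp [ENNReal.mul_eq_top]) (by simp)]
      simp; norm_num

lemma code_sum (q : ENNReal) (hq : q ≤ 1/6) :
    ∑' p : ℕ × List (Fin 3), q ^ (p.1 + 1 + p.2.length) ≤ 1 := by
  rw [ENNReal.tsum_prod (f := fun (a : ℕ) (b : List (Fin 3)) => q ^ (a + 1 + b.length))]
  simp only [pow_add q (_ + 1), ENNReal.tsum_mul_left, ENNReal.tsum_mul_right]
  calc _ ≤ (1/2 : ENNReal) * 2 := by
        gcongr
        · exact nat_sum q hq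
        · exact list_sum q hq
    _ = 1 := by simp [ENNReal.inv_mul_cancel]

/-- Extension by zero. -/
def ex (Λ : Finset Site) (g : {x // x ∈ Λ} → ℤ) : Config := extendC Λ 0 g

lemma ex_off (Λ : Finset Site) (g : {x // x ∈ Λ} → ℤ) (y : Site) (hy : y ∉ Λ) : ex Λ g y = 0 := by
  simp [ex, extendC, hy]

lemma ex_on (Λ : Finset Site) (g : {x // x ∈ Λ} → ℤ) (y : Site) (hy : y ∈ Λ) :
    ex Λ g y = g ⟨y, hy⟩ := by
  simp [ex, extendC, hy]

lemma shift_sum (Λ : Finset Site) (w : Config) (hw : ∀ y, y ∉ Λ → w y = 0)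
    (F : Config → ENNReal) : ∑' g, F (ex Λ g - w) = ∑' g, F (ex Λ g) := by
  rw [← (Equiv.subRight (fun x : {x // x ∈ Λ} => w x.1)).tsum_eq (fun g => F (ex Λ g))]
  refine tsum_congr fun g => ?_
  congr 1
  funext y
  by_cases hy : y ∈ Λ
  · simp [ex_on, hy]
  · simp [ex_off, hy, hw]

lemma neg_sum (Λ : Finset Site) (F : Config → ENNReal) :
    ∑' g, F (-(ex Λ g)) = ∑' g, F (ex Λ g) := by
  rw [← (Equiv.neg ({x // x ∈ Λ} → ℤ)).tsum_eq (fun g => F (ex Λ g))]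
  refine tsum_congr fun g => ?_
  congr 1
  funext y
  by_cases hy : y ∈ Λ
  · simp [ex_on, hy]
  · simp [ex_off, hy]

/-- Truncated weight. -/
def Wt (β : ℝ) (Λ : Finset Site) (N : ℝ) (η : Config) : ENNReal :=
  if sosH Λ 0 η ≤ N then ENNReal.ofReal (Real.exp (-β * sosH Λ 0 η)) else 0

/-- Tilt exponent. -/
def Phi (R : Finset Site) (η : Config) : ℤ := ∑ y ∈ R, max (η y) 0

/-- Tilt factor. -/
def tilt (c : ℝ) (R : Finset Site) (η : Config) : ENNReal := ENNReal.ofReal (Real.exp (c * Phi R η))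

/-- Probe event. -/
def Ev (x : Site) (U : Finset Site) (j : ℕ) (η : Config) : Prop :=
  j = 0 ∨ ((j:ℤ) ≤ η x ∧ ∀ u ∈ U, (j:ℤ) ≤ η (x + u))

/-- Tilted tail sum. -/
def TT (β : ℝ) (Λ : Finset Site) (N c : ℝ) (R : Finset Site) (x : Site) (U : Finset Site) (j : ℕ) :
    ENNReal :=
  ∑' g, Wt β Λ N (ex Λ g) * tilt c R (ex Λ g) * (if Ev x U j (ex Λ g) then 1 else 0)

lemma term_le {Λ : Finset Site} {M : ℤ} (hM : Bd Λ M) (β N c : ℝ) (hβ : 0 ≤ β) (hc : 0 ≤ c)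
    (R : Finset Site)
    (hR : Set.InjOn Prod.snd (R : Set Site)) (η w : Config) (hη : ∀ y, y ∉ Λ → η y = 0)
    (hp : Peel Λ η w) :
    Wt β Λ N η * tilt c R η ≤ ENNReal.ofReal (Real.exp (-(β - c) * pp M w)) *
      (Wt β Λ N (η - w) * tilt c R (η - w)) := by
  have h1 := peel_energy η w hη hp
  have h2 : sosH Λ 0 w = pp M w := energy hM w hp.1
  have h3 : sosH Λ 0 (η - w) = pp M (η - w) := energy hM _ (fun y hy => by simp [hη y hy, hp.1 y hy])
  have h4 : (0:ℝ) ≤ pp M w := by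
    have a1 := pdir_nonneg M w (-1,0)
    have a2 := pdir_nonneg M w (1,0)
    have a3 := pdir_nonneg M w (0,-1)
    have a4 := pdir_nonneg M w (0,1)
    have : 0 ≤ pp M w := by rw [pp_eq]; omega
    exact_mod_cast this
  have h5 : (Phi R η : ℝ) ≤ Phi R (η - w) + pp M w := by
    have := pp_rows hM w hp.1 R hR
    have h6 : Phi R η ≤ Phi R (η - w) + ∑ x ∈ R, max (w x) 0 := by
      unfold Phi
      rw [← Finset.sum_add_distrib]
      apply Finset.sum_le_sum
      intro y _
      simp only [Pi.sub_apply]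
      omega
    exact_mod_cast h6.trans (by omega)
  unfold Wt tilt
  split_ifs with ha hb
  · rw [← ENNReal.ofReal_mul (Real.exp_nonneg _), ← ENNReal.ofReal_mul (Real.exp_nonneg _),
      ← ENNReal.ofReal_mul (Real.exp_nonneg _), ← Real.exp_add, ← Real.exp_add, ← Real.exp_add]
    apply ENNReal.ofReal_le_ofReal
    apply Real.exp_le_exp.2
    rw [h1, h2]
    nlinarith [mul_le_mul_of_nonneg_left h5 hc]
  · exfalso; apply hb; linarith
  · simp
  · simp

lemma tail {Λ : Finset Site} {M : ℤ} (hM : Bd Λ M) (hΛ : VRay Λ) (β N c b ρ : ℝ)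
    (hb : 0 ≤ b) (hc : 0 ≤ c) (ha : 4 ≤ β - c - b) (R : Finset Site)
    (hR : Set.InjOn Prod.snd (R : Set Site)) (x : Site) (U : Finset Site) (hU : U ⊆ dirs)
    (hρ0 : 0 ≤ ρ)
    (hρ : ∀ w : Config, (∀ y, y ∉ Λ → w y = 0) → (∀ u ∈ U, w (x + u) = w x) → ρ * w x ≤ pp M w)
    (j : ℕ) :
    TT β Λ N c R x U j ≤ ENNReal.ofReal (Real.exp (-(b * ρ * j))) * TT β Λ N c R x U 0 := by
  induction j using Nat.strong_induction_on with
  | _ j ih =>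
  rcases Nat.eq_zero_or_pos j with rfl | hj
  · simp
  set good : ℕ × List (Fin 3) → Prop := fun p =>
    (∀ y, y ∉ Λ → cw x p.1 p.2 y = 0) ∧ 1 ≤ cw x p.1 p.2 x ∧ ρ * cw x p.1 p.2 x ≤ pp M (cw x p.1 p.2)
      ∧ (p.1 : ℤ) + 1 + p.2.length ≤ 2 * pp M (cw x p.1 p.2) with hgood
  set F : ℕ → Config → ENNReal := fun j η =>
    Wt β Λ N η * tilt c R η * (if Ev x U j η then 1 else 0) with hF
  have step : ∀ g, F j (ex Λ g) ≤ ∑' p : ℕ × List (Fin 3), if good p then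
      ENNReal.ofReal (Real.exp (-(β - c) * pp M (cw x p.1 p.2))) *
        F (j - (cw x p.1 p.2 x).toNat) (ex Λ g - cw x p.1 p.2) else 0 := by
    intro g
    by_cases hE : Ev x U j (ex Λ g)
    swap
    · simp only [hF, hE, if_false, mul_zero]; exact zero_le
    rcases hE with h0 | ⟨hx, hu⟩
    · omega
    obtain ⟨k, t, hp, h1, h2, h3, S, hS, h4⟩ := contour hM hΛ (ex Λ g) (ex_off Λ g) x (by omega)
    have hgd : good (k, t) := by
      refine ⟨hp.1, h1, hρ _ hp.1 fun u hu' => h2 u (hU hu') (by have := hu u hu'; omega), ?_⟩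
      have e1 := pp_k hM _ hp.1 x k h3
      have e2 := pp_card hM _ S h4
      rw [hS] at e2
      simp only
      omega
    refine le_trans ?_ (ENNReal.le_tsum (k, t))
    rw [if_pos hgd]
    simp only [hF]
    have hE' : Ev x U (j - (cw x k t x).toNat) (ex Λ g - cw x k t) := by
      by_cases hz : j - (cw x k t x).toNat = 0
      · left; exact hz
      right
      refine ⟨?_, fun u hu' => ?_⟩
      · simp only [Pi.sub_apply]; omega
      · have e := h2 u (hU hu') (by have := hu u hu'; omega)
        have := hu u hu'
        simp only [Pi.sub_apply]; omega
    rw [if_pos hE', mul_one]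
    refine le_trans ?_ (term_le hM β N c (by linarith) hc R hR (ex Λ g) _ (ex_off Λ g) hp)
    split_ifs <;> simp
  have q16 : ENNReal.ofReal (Real.exp (-2)) ≤ 1/6 := by
    rw [ENNReal.ofReal_le_iff_le_toReal (by simp)]
    simp only [one_div, ENNReal.toReal_inv, ENNReal.toReal_ofNat]
    rw [Real.exp_neg]
    gcongr
    have := Real.exp_one_gt_d9
    have e : Real.exp 2 = Real.exp 1 * Real.exp 1 := by rw [← Real.exp_add]; norm_num
    rw [e]; nlinarith
  calc TT β Λ N c R x U j = ∑' g, F j (ex Λ g) := rfl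
    _ ≤ ∑' g, ∑' p : ℕ × List (Fin 3), if good p then
      ENNReal.ofReal (Real.exp (-(β - c) * pp M (cw x p.1 p.2))) *
        F (j - (cw x p.1 p.2 x).toNat) (ex Λ g - cw x p.1 p.2) else 0 := ENNReal.tsum_le_tsum step
    _ = ∑' p : ℕ × List (Fin 3), ∑' g, if good p then
      ENNReal.ofReal (Real.exp (-(β - c) * pp M (cw x p.1 p.2))) *
        F (j - (cw x p.1 p.2 x).toNat) (ex Λ g - cw x p.1 p.2) else 0 := ENNReal.tsum_comm
    _ ≤ ∑' p : ℕ × List (Fin 3), ENNReal.ofReal (Real.exp (-2)) ^ (p.1 + 1 + p.2.length) *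
        (ENNReal.ofReal (Real.exp (-(b * ρ * j))) * TT β Λ N c R x U 0) := by
      refine ENNReal.tsum_le_tsum fun p => ?_
      by_cases hg : good p
      swap
      · simp [hg]
      simp only [hg, if_true]
      obtain ⟨g1, g2, g3, g4⟩ := hg
      rw [ENNReal.tsum_mul_left, shift_sum Λ _ g1 (F (j - (cw x p.1 p.2 x).toNat))]
      set m := (cw x p.1 p.2 x).toNat with hm
      have hm' : cw x p.1 p.2 x = m := by omega
      have := ih (j - m) (by omega)
      change _ * TT β Λ N c R x U (j - m) ≤ _
      refine (mul_le_mul_right this _).trans ?_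
      rw [← mul_assoc, ← mul_assoc]
      refine mul_le_mul_left ?_ _
      rw [← ENNReal.ofReal_pow (Real.exp_nonneg _), ← ENNReal.ofReal_mul (Real.exp_nonneg _),
        ← ENNReal.ofReal_mul (by positivity)]
      apply ENNReal.ofReal_le_ofReal
      rw [← Real.exp_nat_mul, ← Real.exp_add, ← Real.exp_add]
      apply Real.exp_le_exp.2
      rw [hm'] at g3
      have g4' : (p.1 : ℝ) + 1 + p.2.length ≤ 2 * pp M (cw x p.1 p.2) := by exact_mod_cast g4
      have g5 : (j:ℝ) ≤ m + (j - m : ℕ) := by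
        have : j ≤ m + (j - m) := by omega
        exact_mod_cast this
      have hp0 : (0:ℝ) ≤ pp M (cw x p.1 p.2) := by nlinarith [Nat.cast_nonneg (α := ℝ) p.1, Nat.cast_nonneg (α := ℝ) p.2.length]
      push_cast at g3 ⊢
      have e1 := mul_le_mul_of_nonneg_left g5 (mul_nonneg hb hρ0)
      have e2 := mul_le_mul_of_nonneg_left g3 hb
      have e3 := mul_le_mul_of_nonneg_right ha hp0
      nlinarith
    _ ≤ _ := by
      rw [ENNReal.tsum_mul_right]
      calc _ ≤ 1 * (ENNReal.ofReal (Real.exp (-(b * ρ * j))) * TT β Λ N c R x U 0) :=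
            mul_le_mul_left (code_sum _ q16) _
        _ = _ := one_mul _


/-- Truncated partition function. -/
def Zt (β : ℝ) (Λ : Finset Site) (N : ℝ) : ENNReal := ∑' g, Wt β Λ N (ex Λ g)

lemma pp_four' {Λ : Finset Site} {M : ℤ} (hM : Bd Λ M) (x : Site) (U : Finset Site) :
    ∀ w : Config, (∀ y, y ∉ Λ → w y = 0) → (∀ u ∈ U, w (x + u) = w x) →
      (4:ℝ) * w x ≤ pp M w := by
  intro w hw _
  exact_mod_cast pp_four hM w hw x

lemma expmom {Λ : Finset Site} {M : ℤ} (hM : Bd Λ M) (hΛ : VRay Λ) (β N : ℝ) (hβ : 100 ≤ β)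
    (R : Finset Site) (hR : Set.InjOn Prod.snd (R : Set Site)) :
    ∑' g, Wt β Λ N (ex Λ g) * tilt 1 R (ex Λ g) ≤ 2 ^ R.card * Zt β Λ N := by
  induction R using Finset.induction_on with
  | empty => simp [tilt, Phi, Zt]
  | insert x R hx ih =>
    have hR' : Set.InjOn Prod.snd (R : Set Site) := hR.mono (by simp)
    have ih := ih hR'
    have h0 : TT β Λ N 1 R x ∅ 0 = ∑' g, Wt β Λ N (ex Λ g) * tilt 1 R (ex Λ g) := by
      simp [TT, Ev]
    have ht := fun j => tail hM hΛ β N 1 2 4 (by norm_num) (by norm_num) (by linarith) R hR' x ∅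
      (by simp) (by norm_num) (pp_four' hM x ∅) j
    have step : ∀ g, Wt β Λ N (ex Λ g) * tilt 1 (insert x R) (ex Λ g) ≤
        ∑' j : ℕ, ENNReal.ofReal (Real.exp j) *
          (Wt β Λ N (ex Λ g) * tilt 1 R (ex Λ g) * (if Ev x ∅ j (ex Λ g) then 1 else 0)) := by
      intro g
      refine le_trans ?_ (ENNReal.le_tsum (ex Λ g x).toNat)
      have hE : Ev x ∅ (ex Λ g x).toNat (ex Λ g) := by
        by_cases h : (ex Λ g x).toNat = 0
        · left; exact h
        · right; exact ⟨by omega, by simp⟩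
      rw [if_pos hE, mul_one]
      have e : tilt 1 (insert x R) (ex Λ g) = ENNReal.ofReal (Real.exp ((ex Λ g x).toNat : ℝ)) *
          tilt 1 R (ex Λ g) := by
        unfold tilt Phi
        rw [← ENNReal.ofReal_mul (Real.exp_nonneg _), ← Real.exp_add, Finset.sum_insert hx]
        congr 2
        have : (((ex Λ g x).toNat : ℤ) : ℝ) = ((max (ex Λ g x) 0 : ℤ) : ℝ) := by
          congr 1; omega
        rw [Int.cast_natCast] at this
        rw [this, one_mul, one_mul, ← Int.cast_add]
      rw [e]
      exact le_of_eq (by ring)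
    calc _ ≤ ∑' g, ∑' j : ℕ, ENNReal.ofReal (Real.exp j) *
          (Wt β Λ N (ex Λ g) * tilt 1 R (ex Λ g) * (if Ev x ∅ j (ex Λ g) then 1 else 0)) :=
          ENNReal.tsum_le_tsum step
      _ = ∑' j : ℕ, ENNReal.ofReal (Real.exp j) * TT β Λ N 1 R x ∅ j := by
          rw [ENNReal.tsum_comm]
          simp only [ENNReal.tsum_mul_left]; rfl
      _ ≤ ∑' j : ℕ, (1/2 : ENNReal) ^ j * TT β Λ N 1 R x ∅ 0 := by
          refine ENNReal.tsum_le_tsum fun j => ?_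
          refine (mul_le_mul_right (ht j) _).trans ?_
          rw [← mul_assoc]
          refine mul_le_mul_left ?_ _
          rw [← ENNReal.ofReal_mul (Real.exp_nonneg _), ← Real.exp_add]
          have e1 : (j:ℝ) + -(2 * 4 * j) = j * (-7) := by ring
          rw [e1, Real.exp_nat_mul, ENNReal.ofReal_pow (Real.exp_nonneg _)]
          gcongr
          rw [ENNReal.ofReal_le_iff_le_toReal (by simp)]
          simp only [one_div, ENNReal.toReal_inv, ENNReal.toReal_ofNat]
          rw [Real.exp_neg]
          gcongr
          have := Real.add_one_le_exp (7:ℝ)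
          linarith
      _ = 2 * TT β Λ N 1 R x ∅ 0 := by
          rw [ENNReal.tsum_mul_right, ENNReal.tsum_geometric]
          simp
      _ ≤ _ := by
          rw [h0, Finset.card_insert_of_notMem hx, pow_succ', mul_assoc]
          gcongr

lemma peel_single {Λ : Finset Site} (η : Config) (x : Site) (hx : x ∈ Λ)
    (h : ∀ u ∈ dirs, η (x + u) < η x) : Peel Λ η (Pi.single x 1) := by
  constructor
  · intro y hy
    rw [Pi.single_eq_of_ne]
    rintro rfl; exact hy hx
  · intro y u hu
    have hu0 : u ≠ 0 := by
      rw [mem_dirs] at hu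
      rcases hu with rfl | rfl | rfl | rfl <;> simp
    by_cases h1 : y = x
    · subst h1
      have := h u hu
      rw [Pi.single_eq_same, Pi.single_eq_of_ne (by simpa using hu0)]
      rw [abs_of_pos (by omega), abs_of_nonneg (by omega)]; simp; ring
    · by_cases h2 : y + u = x
      · have e : y = x + -u := by rw [← h2]; simp
        have h3 := h (-u) (neg_mem hu)
        rw [← e] at h3
        rw [h2, Pi.single_eq_same, Pi.single_eq_of_ne h1]
        rw [abs_of_neg (by omega), abs_of_nonpos (by omega)]; simp; ring
      · rw [Pi.single_eq_of_ne h1, Pi.single_eq_of_ne h2]; simp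

lemma spike_step {Λ : Finset Site} {M : ℤ} (hM : Bd Λ M) (β N : ℝ) (hβ : 0 ≤ β)
    (x : Site) (k : ℕ) :
    TT β Λ N 0 ∅ x ∅ (k+1) ≤ ENNReal.ofReal (Real.exp (-(4*β))) * TT β Λ N 0 ∅ x ∅ k +
      ∑ u ∈ dirs, TT β Λ N 0 ∅ x {u} (k+1) := by
  set w : Config := Pi.single x 1 with hw
  by_cases hx : x ∈ Λ
  swap
  · have : TT β Λ N 0 ∅ x ∅ (k+1) = 0 := by
      unfold TT
      rw [ENNReal.tsum_eq_zero]
      intro g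
      have : ¬ Ev x ∅ (k+1) (ex Λ g) := by
        rintro (h | ⟨h, _⟩)
        · omega
        · rw [ex_off Λ g x hx] at h; push_cast at h; omega
      rw [if_neg this, mul_zero]
    rw [this]; exact zero_le
  have hw0 : ∀ y, y ∉ Λ → w y = 0 := by
    intro y hy
    rw [hw, Pi.single_eq_of_ne]
    rintro rfl; exact hy hx
  set F : Config → ENNReal := fun η =>
    Wt β Λ N η * tilt 0 ∅ η * (if Ev x ∅ k η then 1 else 0) with hF
  have e1 : TT β Λ N 0 ∅ x ∅ k = ∑' g, F (ex Λ g - w) := by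
    rw [shift_sum Λ w hw0 F]; rfl
  rw [e1]
  unfold TT
  rw [← Summable.tsum_finsetSum (fun _ _ => ENNReal.summable), ← ENNReal.tsum_mul_left,
    ← ENNReal.tsum_add]
  refine ENNReal.tsum_le_tsum fun g => ?_
  by_cases hE : Ev x ∅ (k+1) (ex Λ g)
  swap
  · rw [if_neg hE, mul_zero]; exact zero_le
  rw [if_pos hE, mul_one]
  rcases hE with h0 | ⟨hE, _⟩
  · omega
  by_cases hn : ∃ u ∈ dirs, ((k+1 : ℕ):ℤ) ≤ ex Λ g (x + u)
  · obtain ⟨u, hu, hk⟩ := hn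
    refine le_trans ?_ le_add_self
    refine le_trans ?_ (Finset.single_le_sum (f := fun u => Wt β Λ N (ex Λ g) * tilt 0 ∅ (ex Λ g) *
      (if Ev x {u} (k+1) (ex Λ g) then 1 else 0)) (fun _ _ => zero_le) hu)
    have : Ev x {u} (k+1) (ex Λ g) := Or.inr ⟨hE, by simpa using hk⟩
    simp only [if_pos this, mul_one]; exact le_rfl
  · push Not at hn
    refine le_trans ?_ le_self_add
    have hp : Peel Λ (ex Λ g) w := peel_single _ x hx fun u hu => by have := hn u hu; omega
    refine (term_le hM β N 0 hβ le_rfl ∅ (by simp) _ w (ex_off Λ g) hp).trans ?_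
    have hE' : Ev x ∅ k (ex Λ g - w) := by
      right
      refine ⟨?_, by simp⟩
      simp only [Pi.sub_apply, hw, Pi.single_eq_same]
      push_cast at hE; omega
    simp only [hF, if_pos hE', mul_one]
    refine mul_le_mul_left ?_ _
    apply ENNReal.ofReal_le_ofReal
    apply Real.exp_le_exp.2
    have h4 := pp_four hM w hw0 x
    have : w x = 1 := by simp [hw]
    rw [this] at h4
    have h4' : (4:ℝ) ≤ pp M w := by exact_mod_cast h4
    nlinarith

lemma spike {Λ : Finset Site} {M : ℤ} (hM : Bd Λ M) (hΛ : VRay Λ) (β N : ℝ) (hβ : 100 ≤ β)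
    (x : Site) (k : ℕ) :
    TT β Λ N 0 ∅ x ∅ k ≤ ENNReal.ofReal (2 * Real.exp (-(4*β*k))) * Zt β Λ N := by
  have h0 : ∀ U, TT β Λ N 0 ∅ x U 0 = Zt β Λ N := by
    intro U; simp [TT, Ev, tilt, Zt]
  have hpair : ∀ u ∈ dirs, ∀ j : ℕ, TT β Λ N 0 ∅ x {u} j ≤
      ENNReal.ofReal (Real.exp (-(4.5 * β * j))) * Zt β Λ N := by
    intro u hu j
    have := tail hM hΛ β N 0 (0.75*β) 6 (by linarith) le_rfl (by linarith) ∅ (by simp) x {u}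
      (by simpa using hu) (by norm_num) (fun w hw hu' => by
        exact_mod_cast pp_six hM w hw x u hu (hu' u (by simp))) j
    rw [h0] at this
    convert this using 5
    ring
  set s := Real.exp (-(β/2)) with hs
  have hs5 : 5 * s ≤ 1 := by
    have h1 : s ≤ Real.exp (-4) := Real.exp_le_exp.2 (by linarith)
    have h2 := Real.add_one_le_exp (4:ℝ)
    have h3 : Real.exp (-4) * Real.exp 4 = 1 := by rw [← Real.exp_add]; simp
    nlinarith [Real.exp_pos (-4)]
  have hs0 : 0 < s := Real.exp_pos _
  have key : TT β Λ N 0 ∅ x ∅ k ≤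
      ENNReal.ofReal ((2 - s^k) * Real.exp (-(4*β*k))) * Zt β Λ N := by
    induction k with
    | zero => rw [h0]; norm_num
    | succ k ih =>
      refine (spike_step hM β N (by linarith) x k).trans ?_
      have hsum : ∑ u ∈ dirs, TT β Λ N 0 ∅ x {u} (k+1) ≤
          ENNReal.ofReal (4 * Real.exp (-(4.5 * β * (k+1 : ℕ)))) * Zt β Λ N := by
        refine (Finset.sum_le_sum fun u hu => hpair u hu (k+1)).trans ?_
        rw [Finset.sum_const]
        have : dirs.card = 4 := by decide
        rw [this, nsmul_eq_mul, ENNReal.ofReal_mul (by norm_num), mul_assoc]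
        simp [mul_assoc]
      refine (add_le_add (mul_le_mul_right ih _) hsum).trans ?_
      have hk1 : s^k ≤ 1 := pow_le_one₀ hs0.le (by linarith)
      rw [← mul_assoc, ← add_mul, ← ENNReal.ofReal_mul (Real.exp_nonneg _),
        ← ENNReal.ofReal_add (mul_nonneg (Real.exp_nonneg _)
          (mul_nonneg (by linarith) (Real.exp_nonneg _))) (by positivity)]
      refine mul_le_mul_left ?_ _
      apply ENNReal.ofReal_le_ofReal
      have e1 : Real.exp (-(4.5 * β * (k+1 : ℕ))) = Real.exp (-(4*β*(k+1:ℕ))) * s^(k+1) := by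
        rw [hs, ← Real.exp_nat_mul, ← Real.exp_add]; congr 1; push_cast; ring
      have e2 : Real.exp (-(4*β*(k+1:ℕ))) = Real.exp (-(4*β)) * Real.exp (-(4*β*k)) := by
        rw [← Real.exp_add]; congr 1; push_cast; ring
      rw [e1, e2]
      have hE : 0 < Real.exp (-(4*β)) * Real.exp (-(4*β*k)) := by positivity
      have : 5 * s^(k+1) ≤ s^k := by
        rw [pow_succ]; nlinarith [pow_pos hs0 k]
      nlinarith
  refine key.trans (mul_le_mul_left (ENNReal.ofReal_le_ofReal ?_) _)
  have := pow_pos hs0 k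
  gcongr
  linarith

lemma spike_up {Λ : Finset Site} {M : ℤ} (hM : Bd Λ M) (hΛ : VRay Λ) (β N : ℝ) (hβ : 100 ≤ β)
    (x : Site) (k : ℕ) :
    ∑' g, (if (k:ℤ) ≤ ex Λ g x then Wt β Λ N (ex Λ g) else 0) ≤
      ENNReal.ofReal (2 * Real.exp (-(4*β*k))) * Zt β Λ N := by
  refine le_trans (ENNReal.tsum_le_tsum fun g => ?_) (spike hM hΛ β N hβ x k)
  split_ifs with h1 h2 h3
  · simp [tilt, Phi]
  · exact absurd (Or.inr ⟨h1, by simp⟩) h2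
  · simp
  · simp

lemma Wt_neg (β N : ℝ) (Λ : Finset Site) (η : Config) : Wt β Λ N (-η) = Wt β Λ N η := by
  have : sosH Λ 0 (-η) = sosH Λ 0 η := by
    unfold sosH
    have e1 : ∀ a b : ℤ, |-a - -b| = |a - b| := by intro a b; rw [← abs_neg]; congr 1; ring
    have e2 : ∀ a : ℤ, |-a - 0| = |a - 0| := by intro a; rw [← abs_neg]; congr 1; ring
    simp only [Pi.neg_apply, Pi.zero_apply, e1, e2]
  unfold Wt
  rw [this]

lemma spike_dn {Λ : Finset Site} {M : ℤ} (hM : Bd Λ M) (hΛ : VRay Λ) (β N : ℝ) (hβ : 100 ≤ β)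
    (x : Site) (k : ℕ) :
    ∑' g, (if ex Λ g x ≤ -(k:ℤ) then Wt β Λ N (ex Λ g) else 0) ≤
      ENNReal.ofReal (2 * Real.exp (-(4*β*k))) * Zt β Λ N := by
  refine le_trans (le_of_eq ?_) (spike_up hM hΛ β N hβ x k)
  rw [← neg_sum Λ (fun η => if (k:ℤ) ≤ η x then Wt β Λ N η else 0)]
  refine tsum_congr fun g => ?_
  rw [Wt_neg]
  have : ((k:ℤ) ≤ (-(ex Λ g)) x) ↔ ex Λ g x ≤ -(k:ℤ) := by
    simp only [Pi.neg_apply]; omega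
  simp only [this]


/-- Real weight. -/
def mu (β : ℝ) (Λ : Finset Site) (g : {x // x ∈ Λ} → ℤ) : ℝ := Real.exp (-β * sosH Λ 0 (ex Λ g))

lemma mu_pos (β : ℝ) (Λ : Finset Site) (g : {x // x ∈ Λ} → ℤ) : 0 < mu β Λ g := Real.exp_pos _

lemma abs_minmax (a b c d : ℤ) :
    |min a b - min c d| + |max a b - max c d| ≤ |a - c| + |b - d| := by
  rcases le_total a b with h1 | h1 <;> rcases le_total c d with h2 | h2 <;>
    simp only [min_eq_left, min_eq_right, max_eq_left, max_eq_right, h1, h2] <;>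
    rcases abs_cases (a - c) with ⟨h3, _⟩ | ⟨h3, _⟩ <;>
    rcases abs_cases (b - d) with ⟨h4, _⟩ | ⟨h4, _⟩ <;>
    rcases abs_cases (a - d) with ⟨h5, _⟩ | ⟨h5, _⟩ <;>
    rcases abs_cases (b - c) with ⟨h6, _⟩ | ⟨h6, _⟩ <;> omega

lemma ex_inf (Λ : Finset Site) (a b : {x // x ∈ Λ} → ℤ) (y : Site) :
    ex Λ (a ⊓ b) y = min (ex Λ a y) (ex Λ b y) := by
  by_cases hy : y ∈ Λ
  · simp [ex_on, hy]
  · simp [ex_off, hy]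

lemma ex_sup (Λ : Finset Site) (a b : {x // x ∈ Λ} → ℤ) (y : Site) :
    ex Λ (a ⊔ b) y = max (ex Λ a y) (ex Λ b y) := by
  by_cases hy : y ∈ Λ
  · simp [ex_on, hy]
  · simp [ex_off, hy]

lemma sosH_sub (Λ : Finset Site) (a b : {x // x ∈ Λ} → ℤ) :
    sosH Λ 0 (ex Λ (a ⊓ b)) + sosH Λ 0 (ex Λ (a ⊔ b)) ≤ sosH Λ 0 (ex Λ a) + sosH Λ 0 (ex Λ b) := by
  unfold sosH
  have h1 : ∑ x ∈ Λ, ∑ y ∈ (nbrs x).filter (fun y => y ∈ Λ),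
        ((|ex Λ (a ⊓ b) x - ex Λ (a ⊓ b) y| : ℤ) : ℝ) +
      ∑ x ∈ Λ, ∑ y ∈ (nbrs x).filter (fun y => y ∈ Λ),
        ((|ex Λ (a ⊔ b) x - ex Λ (a ⊔ b) y| : ℤ) : ℝ) ≤
      ∑ x ∈ Λ, ∑ y ∈ (nbrs x).filter (fun y => y ∈ Λ), ((|ex Λ a x - ex Λ a y| : ℤ) : ℝ) +
      ∑ x ∈ Λ, ∑ y ∈ (nbrs x).filter (fun y => y ∈ Λ), ((|ex Λ b x - ex Λ b y| : ℤ) : ℝ) := by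
    simp only [← Finset.sum_add_distrib]
    refine Finset.sum_le_sum fun x _ => Finset.sum_le_sum fun y _ => ?_
    simp only [ex_inf, ex_sup]
    exact_mod_cast abs_minmax _ _ _ _
  have h2 : ∑ x ∈ Λ, ∑ y ∈ (nbrs x).filter (fun y => y ∉ Λ),
        ((|ex Λ (a ⊓ b) x - (0 : Config) y| : ℤ) : ℝ) +
      ∑ x ∈ Λ, ∑ y ∈ (nbrs x).filter (fun y => y ∉ Λ),
        ((|ex Λ (a ⊔ b) x - (0 : Config) y| : ℤ) : ℝ) ≤
      ∑ x ∈ Λ, ∑ y ∈ (nbrs x).filter (fun y => y ∉ Λ), ((|ex Λ a x - (0 : Config) y| : ℤ) : ℝ) +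
      ∑ x ∈ Λ, ∑ y ∈ (nbrs x).filter (fun y => y ∉ Λ), ((|ex Λ b x - (0 : Config) y| : ℤ) : ℝ) := by
    simp only [← Finset.sum_add_distrib]
    refine Finset.sum_le_sum fun x _ => Finset.sum_le_sum fun y _ => ?_
    simp only [ex_inf, ex_sup]
    have := abs_minmax (ex Λ a x) (ex Λ b x) 0 0
    simp only [min_self, max_self] at this
    exact_mod_cast this
  linarith

lemma mu_fkg (β : ℝ) (hβ : 0 ≤ β) (Λ : Finset Site) (a b : {x // x ∈ Λ} → ℤ) :
    mu β Λ a * mu β Λ b ≤ mu β Λ (a ⊓ b) * mu β Λ (a ⊔ b) := by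
  unfold mu
  rw [← Real.exp_add, ← Real.exp_add]
  apply Real.exp_le_exp.2
  nlinarith [mul_le_mul_of_nonneg_left (sosH_sub Λ a b) hβ]

lemma fkg_prod (β : ℝ) (hβ : 0 ≤ β) (Λ : Finset Site) (n m h : ℤ) (p : ℝ) (hp : 0 ≤ p)
    (hx : ∀ x : {x // x ∈ Λ}, p * ∑ g ∈ Fintype.piFinset (fun _ => Finset.Icc (-n) m), mu β Λ g ≤
      ∑ g ∈ (Fintype.piFinset (fun _ => Finset.Icc (-n) m)).filter (fun g => -h ≤ g x), mu β Λ g)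
    (S : Finset {x // x ∈ Λ}) :
    p ^ S.card * ∑ g ∈ Fintype.piFinset (fun _ => Finset.Icc (-n) m), mu β Λ g ≤
      ∑ g ∈ (Fintype.piFinset (fun _ => Finset.Icc (-n) m)).filter (fun g => ∀ x ∈ S, -h ≤ g x),
        mu β Λ g := by
  set B := Fintype.piFinset (fun _ : {x // x ∈ Λ} => Finset.Icc (-n) m) with hB
  have hlat : ∀ a ∈ B, ∀ b ∈ B, a ⊓ b ∈ B ∧ a ⊔ b ∈ B := by
    intro a ha b hb
    simp only [hB, Fintype.mem_piFinset, Finset.mem_Icc, Pi.inf_apply, Pi.sup_apply] at *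
    constructor <;> intro x <;> have := ha x <;> have := hb x <;> omega
  have hnn : ∀ T : Finset ({x // x ∈ Λ} → ℤ), 0 ≤ ∑ g ∈ T, mu β Λ g := fun T =>
    Finset.sum_nonneg fun g _ => (mu_pos β Λ g).le
  induction S using Finset.induction_on with
  | empty => simp
  | insert x S hxS ih =>
    have h4 := four_functions_theorem (mu β Λ) (mu β Λ) (mu β Λ) (mu β Λ)
      (fun g => (mu_pos β Λ g).le) (fun g => (mu_pos β Λ g).le) (fun g => (mu_pos β Λ g).le)
      (fun g => (mu_pos β Λ g).le) (mu_fkg β hβ Λ)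
      (B.filter (fun g => ∀ x ∈ S, -h ≤ g x)) (B.filter (fun g => -h ≤ g x))
    have h5 : ∑ g ∈ Finset.image₂ (· ⊓ ·) (B.filter (fun g => ∀ x ∈ S, -h ≤ g x))
        (B.filter (fun g => -h ≤ g x)), mu β Λ g ≤ ∑ g ∈ B, mu β Λ g := by
      apply Finset.sum_le_sum_of_subset_of_nonneg
      · intro g hg
        obtain ⟨a, ha, b, hb, rfl⟩ := Finset.mem_image₂.1 hg
        exact (hlat a (Finset.mem_filter.1 ha).1 b (Finset.mem_filter.1 hb).1).1
      · intro g _ _; exact (mu_pos β Λ g).le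
    have h6 : ∑ g ∈ Finset.image₂ (· ⊔ ·) (B.filter (fun g => ∀ x ∈ S, -h ≤ g x))
        (B.filter (fun g => -h ≤ g x)), mu β Λ g ≤
        ∑ g ∈ B.filter (fun g => ∀ y ∈ insert x S, -h ≤ g y), mu β Λ g := by
      apply Finset.sum_le_sum_of_subset_of_nonneg
      · intro g hg
        obtain ⟨a, ha, b, hb, rfl⟩ := Finset.mem_image₂.1 hg
        rw [Finset.mem_filter] at ha hb ⊢
        refine ⟨(hlat a ha.1 b hb.1).2, ?_⟩
        intro y hy
        rw [Finset.mem_insert] at hy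
        rcases hy with rfl | hy
        · exact hb.2.trans le_sup_right
        · exact (ha.2 y hy).trans le_sup_left
      · intro g _ _; exact (mu_pos β Λ g).le
    have h7 := h4.trans (mul_le_mul h5 h6 (hnn _) (hnn _))
    have h8 := mul_le_mul ih (hx x) (mul_nonneg hp (hnn _)) (hnn _)
    rw [Finset.card_insert_of_notMem hxS]
    rcases (hnn B).eq_or_lt with h9 | h9
    · rw [← h9, mul_zero]; exact hnn _
    · have h10 := h8.trans h7
      rw [pow_succ]
      refine le_of_mul_le_mul_left ?_ h9
      calc _ = _ := by ring
        _ ≤ _ := h10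

lemma sosH_nonneg (Λ : Finset Site) (η : Config) : 0 ≤ sosH Λ 0 η := by
  unfold sosH
  have : ∀ a : ℤ, (0:ℝ) ≤ ((|a| : ℤ) : ℝ) := fun a => by exact_mod_cast abs_nonneg a
  refine add_nonneg (mul_nonneg (by norm_num) ?_) ?_ <;>
    exact Finset.sum_nonneg fun _ _ => Finset.sum_nonneg fun _ _ => this _

lemma Zt_ne_top {Λ : Finset Site} {M : ℤ} (hM : Bd Λ M) (β N : ℝ) : Zt β Λ N ≠ ⊤ := by
  have hs : ∀ g ∉ Fintype.piFinset (fun _ : {x // x ∈ Λ} => Finset.Icc (-⌈N⌉) ⌈N⌉),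
      Wt β Λ N (ex Λ g) = 0 := by
    intro g hg
    by_contra hne
    apply hg
    unfold Wt at hne
    have hN : sosH Λ 0 (ex Λ g) ≤ N := by
      by_contra h; exact hne (if_neg h)
    rw [Fintype.mem_piFinset]
    intro x
    have h1 : (pp M (ex Λ g) : ℝ) ≤ N := by rw [← energy hM _ (ex_off Λ g)]; exact hN
    have h2 : (pp M (-ex Λ g) : ℝ) ≤ N := by
      rw [← energy hM _ (fun y hy => by simp [ex_off Λ g y hy])]
      have : sosH Λ 0 (-(ex Λ g)) = sosH Λ 0 (ex Λ g) := by
        unfold sosH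
        have e1 : ∀ a b : ℤ, |-a - -b| = |a - b| := by intro a b; rw [← abs_neg]; congr 1; ring
        have e2 : ∀ a : ℤ, |-a - 0| = |a - 0| := by intro a; rw [← abs_neg]; congr 1; ring
        simp only [Pi.neg_apply, Pi.zero_apply, e1, e2]
      rw [this]; exact hN
    have h3 := pp_four hM _ (ex_off Λ g) x.1
    have h4 := pp_four hM (-ex Λ g) (fun y hy => by simp [ex_off Λ g y hy]) x.1
    have h5 : pp M (ex Λ g) ≤ ⌈N⌉ := by exact_mod_cast h1.trans (Int.le_ceil N)
    have h6 : pp M (-ex Λ g) ≤ ⌈N⌉ := by exact_mod_cast h2.trans (Int.le_ceil N)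
    have h7 : (0:ℤ) ≤ ⌈N⌉ := Int.ceil_nonneg ((sosH_nonneg Λ _).trans hN)
    simp only [Pi.neg_apply, ex_on Λ g x.1 x.2] at h3 h4
    have h8 : g ⟨x.1, x.2⟩ = g x := rfl
    rw [h8] at h3 h4
    rw [Finset.mem_Icc]
    omega
  unfold Zt
  rw [tsum_eq_sum hs]
  refine ENNReal.sum_ne_top.2 fun g _ => ?_
  unfold Wt
  split_ifs <;> simp

lemma Wt_eq (β : ℝ) (Λ : Finset Site) (N : ℝ) (g : {x // x ∈ Λ} → ℤ)
    (h : sosH Λ 0 (ex Λ g) ≤ N) : Wt β Λ N (ex Λ g) = ENNReal.ofReal (mu β Λ g) := by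
  unfold Wt mu; rw [if_pos h]

lemma box_bound {Λ : Finset Site} {M : ℤ} (hM : Bd Λ M) (hΛ : VRay Λ) (β N : ℝ) (hβ : 100 ≤ β)
    (m h : ℕ) (hN : ∀ g ∈ Fintype.piFinset (fun _ : {x // x ∈ Λ} => Finset.Icc (-((m:ℤ)+h)) (m:ℤ)),
      sosH Λ 0 (ex Λ g) ≤ N)
    (hsmall : Λ.card * (4 * Real.exp (-(4 * β * (m + 1)))) ≤ 1/2)
    (hp : 4 * Real.exp (-(4 * β * (h + 1))) ≤ 1) :
    (1 - 4 * Real.exp (-(4 * β * (h + 1)))) ^ Λ.card * (Zt β Λ N).toReal ≤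
      2 * ∑ g ∈ Fintype.piFinset (fun _ : {x // x ∈ Λ} => Finset.Icc (-(h:ℤ)) (m:ℤ)), mu β Λ g := by
  set B := Fintype.piFinset (fun _ : {x // x ∈ Λ} => Finset.Icc (-((m:ℤ)+h)) (m:ℤ)) with hB
  have htop := Zt_ne_top hM β N
  set Z := Zt β Λ N with hZ
  have hnn : ∀ T : Finset ({x // x ∈ Λ} → ℤ), 0 ≤ ∑ g ∈ T, mu β Λ g := fun T =>
    Finset.sum_nonneg fun g _ => (mu_pos β Λ g).le
  have hZr : ENNReal.ofReal Z.toReal = Z := ENNReal.ofReal_toReal htop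
  have hZ0 : 0 ≤ Z.toReal := ENNReal.toReal_nonneg
  -- step 1
  have h1 : Z ≤ ENNReal.ofReal (∑ g ∈ B, mu β Λ g) + ENNReal.ofReal (1/2 * Z.toReal) := by
    have hpt : ∀ g, Wt β Λ N (ex Λ g) ≤ (if g ∈ B then ENNReal.ofReal (mu β Λ g) else 0) +
        ∑ x ∈ Λ, ((if ((m+1 : ℕ):ℤ) ≤ ex Λ g x then Wt β Λ N (ex Λ g) else 0) +
          (if ex Λ g x ≤ -((m+1 : ℕ):ℤ) then Wt β Λ N (ex Λ g) else 0)) := by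
      intro g
      by_cases hg : g ∈ B
      · rw [if_pos hg, Wt_eq β Λ N g (hN g hg)]; exact le_self_add
      · refine le_trans ?_ le_add_self
        have : ∃ x ∈ Λ, ((m+1 : ℕ):ℤ) ≤ ex Λ g x ∨ ex Λ g x ≤ -((m+1 : ℕ):ℤ) := by
          by_contra hc
          push Not at hc
          apply hg
          rw [hB, Fintype.mem_piFinset]
          intro x
          have := hc x.1 x.2
          rw [ex_on Λ g x.1 x.2] at this
          push_cast at this
          have h8 : g ⟨x.1, x.2⟩ = g x := rfl
          rw [h8] at this
          rw [Finset.mem_Icc]; omega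
        obtain ⟨x, hx, hh⟩ := this
        refine le_trans ?_ (Finset.single_le_sum (f := fun x =>
          ((if ((m+1 : ℕ):ℤ) ≤ ex Λ g x then Wt β Λ N (ex Λ g) else 0) +
          (if ex Λ g x ≤ -((m+1 : ℕ):ℤ) then Wt β Λ N (ex Λ g) else 0))) (fun _ _ => zero_le) hx)
        rcases hh with hh | hh
        · simp only [if_pos hh]; exact le_self_add
        · simp only [if_pos hh]; exact le_add_self
    have hsum := ENNReal.tsum_le_tsum hpt
    rw [ENNReal.tsum_add] at hsum
    refine hsum.trans (add_le_add ?_ ?_)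
    · rw [tsum_eq_sum (s := B) (fun g hg => if_neg hg), ENNReal.ofReal_sum_of_nonneg
        (fun g _ => (mu_pos β Λ g).le)]
      exact Finset.sum_le_sum fun g hg => by rw [if_pos hg]
    · rw [Summable.tsum_finsetSum (fun _ _ => ENNReal.summable)]
      calc _ ≤ ∑ x ∈ Λ, ENNReal.ofReal (4 * Real.exp (-(4*β*(m+1)))) * Z := by
            refine Finset.sum_le_sum fun x _ => ?_
            rw [ENNReal.tsum_add]
            refine (add_le_add (spike_up hM hΛ β N hβ x (m+1)) (spike_dn hM hΛ β N hβ x (m+1))).trans ?_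
            rw [← add_mul, ← ENNReal.ofReal_add (by positivity) (by positivity)]
            refine mul_le_mul_left (ENNReal.ofReal_le_ofReal ?_) _
            push_cast
            linarith
        _ = ENNReal.ofReal (Λ.card * (4 * Real.exp (-(4*β*(m+1))))) * Z := by
            rw [Finset.sum_const, nsmul_eq_mul, ENNReal.ofReal_mul (Nat.cast_nonneg _), mul_assoc]
            simp [mul_assoc]
        _ ≤ ENNReal.ofReal (1/2) * Z := mul_le_mul_left (ENNReal.ofReal_le_ofReal hsmall) _
        _ = _ := by rw [ENNReal.ofReal_mul (by norm_num), hZr]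
  have h2 : Z.toReal ≤ 2 * ∑ g ∈ B, mu β Λ g := by
    rw [← ENNReal.ofReal_add (hnn B) (by positivity)] at h1
    have := ENNReal.toReal_le_of_le_ofReal (by have := hnn B; positivity) h1
    linarith
  -- step 2
  have h3 : ∀ x : {x // x ∈ Λ}, (1 - 4 * Real.exp (-(4 * β * (h + 1)))) * ∑ g ∈ B, mu β Λ g ≤
      ∑ g ∈ B.filter (fun g => -(h:ℤ) ≤ g x), mu β Λ g := by
    intro x
    have a1 : ENNReal.ofReal (∑ g ∈ B.filter (fun g => ¬ -(h:ℤ) ≤ g x), mu β Λ g) ≤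
        ENNReal.ofReal (2 * Real.exp (-(4*β*(h+1))) * Z.toReal) := by
      rw [ENNReal.ofReal_mul (by positivity), hZr]
      have := spike_dn hM hΛ β N hβ x.1 (h+1)
      push_cast at this
      refine le_trans ?_ this
      rw [ENNReal.ofReal_sum_of_nonneg (fun g _ => (mu_pos β Λ g).le)]
      refine le_trans (Finset.sum_le_sum ?_) (ENNReal.sum_le_tsum
        (B.filter (fun g => ¬ -(h:ℤ) ≤ g x)))
      intro g hg
      rw [Finset.mem_filter] at hg
      rw [if_pos, Wt_eq β Λ N g (hN g hg.1)]
      rw [ex_on Λ g x.1 x.2]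
      have h8 : g ⟨x.1, x.2⟩ = g x := rfl
      rw [h8]
      have := hg.2
      omega
    have a2 := (ENNReal.ofReal_le_ofReal_iff (by positivity)).1 a1
    have a3 := Finset.sum_filter_add_sum_filter_not B (fun g => -(h:ℤ) ≤ g x) (mu β Λ)
    have a4 : 2 * Real.exp (-(4*β*(h+1))) * Z.toReal ≤
        2 * Real.exp (-(4*β*(h+1))) * (2 * ∑ g ∈ B, mu β Λ g) :=
      mul_le_mul_of_nonneg_left h2 (by positivity)
    linarith
  have h4 := fkg_prod β (by linarith) Λ ((m:ℤ)+h) m h _ (by linarith) h3 Finset.univ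
  have h5 : (Finset.univ : Finset {x // x ∈ Λ}).card = Λ.card := by simp
  rw [h5] at h4
  have h6 : (Fintype.piFinset (fun _ : {x // x ∈ Λ} => Finset.Icc (-((m:ℤ)+h)) (m:ℤ))).filter
      (fun g => ∀ x ∈ (Finset.univ : Finset {x // x ∈ Λ}), -(h:ℤ) ≤ g x) =
      Fintype.piFinset (fun _ : {x // x ∈ Λ} => Finset.Icc (-(h:ℤ)) (m:ℤ)) := by
    ext g
    simp only [Finset.mem_filter, Fintype.mem_piFinset, Finset.mem_Icc, Finset.mem_univ, true_imp_iff]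
    constructor
    · rintro ⟨q1, q2⟩ x; exact ⟨q2 x, (q1 x).2⟩
    · intro q; exact ⟨fun x => ⟨by have := (q x).1; omega, (q x).2⟩, fun x => (q x).1⟩
  rw [h6] at h4
  have h7 := mul_le_mul_of_nonneg_left h2 (pow_nonneg (sub_nonneg.2 hp) Λ.card)
  linarith

lemma bad_bound {Λ : Finset Site} {M : ℤ} (hM : Bd Λ M) (hΛ : VRay Λ) (β : ℝ) (hβ : 100 ≤ β)
    (m h : ℕ)
    (hsmall : Λ.card * (4 * Real.exp (-(4 * β * (m + 1)))) ≤ 1/2)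
    (hp : 4 * Real.exp (-(4 * β * (h + 1))) ≤ 1) (I : Finset ℕ) (R : ℕ → Finset Site)
    (hR : ∀ i, Set.InjOn Prod.snd (R i : Set Site)) (r : ℕ) (hr : ∀ i, (R i).card ≤ r) (t : ℝ) :
    (1 - 4 * Real.exp (-(4 * β * (h + 1)))) ^ Λ.card *
      (∑ g ∈ (Fintype.piFinset (fun _ : {x // x ∈ Λ} => Finset.Icc (-(h:ℤ)) (m:ℤ))).filter
        (fun g => ∃ i ∈ I, t ≤ Phi (R i) (ex Λ g)), mu β Λ g) ≤
      I.card * Real.exp (-t) * 2 ^ r *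
      (2 * ∑ g ∈ Fintype.piFinset (fun _ : {x // x ∈ Λ} => Finset.Icc (-(h:ℤ)) (m:ℤ)), mu β Λ g) := by
  set N : ℝ := ∑ g ∈ Fintype.piFinset (fun _ : {x // x ∈ Λ} => Finset.Icc (-((m:ℤ)+h)) (m:ℤ)),
    sosH Λ 0 (ex Λ g) with hNdef
  have hN : ∀ g ∈ Fintype.piFinset (fun _ : {x // x ∈ Λ} => Finset.Icc (-((m:ℤ)+h)) (m:ℤ)),
      sosH Λ 0 (ex Λ g) ≤ N := fun g hg =>
    Finset.single_le_sum (f := fun g => sosH Λ 0 (ex Λ g)) (fun g _ => sosH_nonneg Λ _) hg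
  have hbox := box_bound hM hΛ β N hβ m h hN hsmall hp
  set C := Fintype.piFinset (fun _ : {x // x ∈ Λ} => Finset.Icc (-(h:ℤ)) (m:ℤ)) with hC
  have htop := Zt_ne_top hM β N
  have hsub : ∀ g ∈ C, sosH Λ 0 (ex Λ g) ≤ N := by
    intro g hg
    apply hN
    simp only [hC, Fintype.mem_piFinset, Finset.mem_Icc] at hg ⊢
    intro x; have := hg x; omega
  have key : ∑ g ∈ C.filter (fun g => ∃ i ∈ I, t ≤ Phi (R i) (ex Λ g)), mu β Λ g ≤
      I.card * Real.exp (-t) * 2 ^ r * (Zt β Λ N).toReal := by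
    rw [← ENNReal.ofReal_le_ofReal_iff (by positivity), ENNReal.ofReal_mul (by positivity),
      ENNReal.ofReal_toReal htop, ENNReal.ofReal_sum_of_nonneg (fun g _ => (mu_pos β Λ g).le)]
    have hi : ∀ i, ENNReal.ofReal (Real.exp (-t)) *
        ∑' g, (Wt β Λ N (ex Λ g) * tilt 1 (R i) (ex Λ g)) ≤
        ENNReal.ofReal (Real.exp (-t)) * (2 ^ r * Zt β Λ N) := by
      intro i
      refine mul_le_mul_right ((expmom hM hΛ β N hβ (R i) (hR i)).trans ?_) _
      refine mul_le_mul_left ?_ _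
      exact pow_le_pow_right₀ (by norm_num) (hr i)
    calc _ ≤ ∑ g ∈ C.filter (fun g => ∃ i ∈ I, t ≤ Phi (R i) (ex Λ g)),
          ∑ i ∈ I, ENNReal.ofReal (Real.exp (-t)) * (Wt β Λ N (ex Λ g) * tilt 1 (R i) (ex Λ g)) := by
          refine Finset.sum_le_sum fun g hg => ?_
          rw [Finset.mem_filter] at hg
          obtain ⟨hg, i, hi, hti⟩ := hg
          refine le_trans ?_ (Finset.single_le_sum (f := fun i => ENNReal.ofReal (Real.exp (-t)) *
            (Wt β Λ N (ex Λ g) * tilt 1 (R i) (ex Λ g))) (fun _ _ => zero_le) hi)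
          rw [Wt_eq β Λ N g (hsub g hg), tilt, ← ENNReal.ofReal_mul (mu_pos β Λ g).le,
            ← ENNReal.ofReal_mul (Real.exp_nonneg _)]
          apply ENNReal.ofReal_le_ofReal
          have e : Real.exp (-t) * (mu β Λ g * Real.exp (1 * Phi (R i) (ex Λ g))) =
            mu β Λ g * Real.exp (-t + 1 * Phi (R i) (ex Λ g)) := by rw [Real.exp_add]; ring
          rw [e]
          exact le_mul_of_one_le_right (mu_pos β Λ g).le (Real.one_le_exp (by linarith))
      _ ≤ ∑' g, ∑ i ∈ I, ENNReal.ofReal (Real.exp (-t)) *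
          (Wt β Λ N (ex Λ g) * tilt 1 (R i) (ex Λ g)) := ENNReal.sum_le_tsum _
      _ = ∑ i ∈ I, ENNReal.ofReal (Real.exp (-t)) *
          ∑' g, (Wt β Λ N (ex Λ g) * tilt 1 (R i) (ex Λ g)) := by
          rw [Summable.tsum_finsetSum (fun _ _ => ENNReal.summable)]
          simp only [ENNReal.tsum_mul_left]
      _ ≤ ∑ i ∈ I, ENNReal.ofReal (Real.exp (-t)) * (2 ^ r * Zt β Λ N) :=
          Finset.sum_le_sum fun i _ => hi i
      _ = _ := by
          rw [Finset.sum_const, nsmul_eq_mul, ENNReal.ofReal_mul (by positivity),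
            ENNReal.ofReal_mul (by positivity), ENNReal.ofReal_pow (by norm_num)]
          simp [mul_assoc]
  have hP := pow_nonneg (sub_nonneg.2 hp) Λ.card
  calc _ ≤ (1 - 4 * Real.exp (-(4 * β * (h + 1)))) ^ Λ.card *
        (I.card * Real.exp (-t) * 2 ^ r * (Zt β Λ N).toReal) := mul_le_mul_of_nonneg_left key hP
    _ = I.card * Real.exp (-t) * 2 ^ r * ((1 - 4 * Real.exp (-(4 * β * (h + 1)))) ^ Λ.card *
        (Zt β Λ N).toReal) := by ring
    _ ≤ _ := mul_le_mul_of_nonneg_left hbox (by positivity)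


lemma rect_mem (L : ℕ) (x : Site) : x ∈ rect2 L ↔ (1 - (L:ℤ) ≤ x.1 ∧ 1 ≤ x.2) ∧ x.1 ≤ L ∧ x.2 ≤ L := by
  unfold rect2
  rw [Finset.mem_Icc, Prod.le_def, Prod.le_def]

lemma rect_bd (L : ℕ) : Bd (rect2 L) ((L:ℤ) + 1) := by
  intro x hx
  rw [rect_mem] at hx
  omega

lemma rect_vray (L : ℕ) : VRay (rect2 L) := by
  intro y hy
  rw [rect_mem] at hy
  by_cases h : y.2 < 1
  · right
    intro n
    rw [rect_mem, Prod.fst_add, Prod.snd_add]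
    simp only
    omega
  · left
    intro n
    rw [rect_mem, Prod.fst_add, Prod.snd_add]
    simp only
    omega

lemma rect_card (L : ℕ) : (rect2 L).card = 2 * L * L := by
  unfold rect2
  have : Finset.Icc (1 - (L : ℤ), (1 : ℤ)) ((L : ℤ), (L : ℤ)) =
    Finset.Icc (1 - (L:ℤ)) L ×ˢ Finset.Icc (1:ℤ) L := rfl
  rw [this, Finset.card_product, Int.card_Icc, Int.card_Icc]
  congr 1 <;> omega

lemma diag_mem (L i : ℕ) (x : Site) : x ∈ diagR L i ↔
    ((1 ≤ x.1 ∧ 1 ≤ x.2) ∧ x.1 ≤ L ∧ x.2 ≤ L) ∧ x.2 = x.1 + (L : ℤ) - (i : ℤ) := by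
  unfold diagR box
  rw [Finset.mem_filter, Finset.mem_Icc, Prod.le_def, Prod.le_def]

lemma diag_inj (L i : ℕ) : Set.InjOn Prod.snd (diagR L i : Set Site) := by
  intro a ha b hb hab
  rw [Finset.mem_coe, diag_mem] at ha hb
  ext
  · omega
  · exact hab

lemma diag_card (L i : ℕ) : (diagR L i).card ≤ L := by
  rw [← Finset.card_image_of_injOn (diag_inj L i)]
  have : (diagR L i).image Prod.snd ⊆ Finset.Icc (1:ℤ) L := by
    intro r hr
    obtain ⟨x, hx, rfl⟩ := Finset.mem_image.1 hr
    rw [diag_mem] at hx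
    rw [Finset.mem_Icc]; omega
  refine (Finset.card_le_card this).trans ?_
  rw [Int.card_Icc]; omega

lemma diag_sub (L i : ℕ) (x : Site) (hx : x ∈ diagR L i) : x ∈ rect2 L := by
  rw [diag_mem] at hx
  rw [rect_mem]; omega

lemma exp_sum (β : ℝ) (hβ : 100 ≤ β) (K : ℤ) :
    ∑ j ∈ Finset.Icc (1 : ℤ) K, Real.exp (-β * (j : ℝ)) ≤ 1 := by
  have h2 : 2 * Real.exp (-β) ≤ 1 := by
    have h1 : Real.exp (-β) ≤ Real.exp (-4) := Real.exp_le_exp.2 (by linarith)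
    have h2 := Real.add_one_le_exp (4:ℝ)
    have h3 : Real.exp (-4) * Real.exp 4 = 1 := by rw [← Real.exp_add]; simp
    nlinarith [Real.exp_pos (-4)]
  have key : ∀ k : ℕ, ∑ j ∈ Finset.Icc (1 : ℤ) k, Real.exp (-β * (j : ℝ)) ≤
      1 - Real.exp (-β * k) := by
    intro k
    induction k with
    | zero => simp
    | succ k ih =>
      have e : Finset.Icc (1:ℤ) ((k+1 : ℕ):ℤ) = insert ((k+1 : ℕ):ℤ) (Finset.Icc (1:ℤ) k) := by
        ext r; simp only [Finset.mem_insert, Finset.mem_Icc]; push_cast; omega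
      rw [e, Finset.sum_insert (by simp)]
      have e2 : Real.exp (-β * ((k+1:ℕ):ℝ)) = Real.exp (-β * k) * Real.exp (-β) := by
        rw [← Real.exp_add]; congr 1; push_cast; ring
      rw [Int.cast_natCast, e2]
      nlinarith [Real.exp_pos (-β * k)]
  rcases le_total 0 K with h | h
  · have := key K.toNat
    rw [Int.toNat_of_nonneg h] at this
    linarith [Real.exp_pos (-β * (K.toNat:ℝ))]
  · rw [Finset.Icc_eq_empty (by omega)]; simp

lemma field_nonneg (β : ℝ) (L : ℕ) (Λ : Finset Site) (η : Config) : 0 ≤ fieldF β L Λ η := by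
  unfold fieldF
  refine mul_nonneg (by positivity) (Finset.sum_nonneg fun _ _ => Finset.sum_nonneg fun _ _ => ?_)
  split_ifs <;> positivity

lemma field_le (β : ℝ) (hβ : 100 ≤ β) (L : ℕ) (hL : 0 < L) (η : Config) :
    fieldF β L (rect2 L) η ≤ 2 * L := by
  unfold fieldF
  have hL' : (0:ℝ) < L := by exact_mod_cast hL
  rw [inv_mul_le_iff₀ hL']
  calc _ ≤ ∑ y ∈ rect2 L, (1:ℝ) := by
        refine Finset.sum_le_sum fun y _ => le_trans ?_ (exp_sum β hβ (ceilN L - eqHt β L))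
        refine Finset.sum_le_sum fun j _ => ?_
        split_ifs <;> simp [Real.exp_nonneg]
    _ = _ := by
        rw [Finset.sum_const, rect_card, nsmul_eq_mul]; push_cast; ring

lemma ext_shift (Λ : Finset Site) (h : ℤ) (g : {x // x ∈ Λ} → ℤ) (y : Site) :
    extendC Λ (fun _ => h) (g + fun _ => h) y = ex Λ g y + h := by
  by_cases hy : y ∈ Λ
  · simp [ex, extendC, hy]
  · simp [ex, extendC, hy]

lemma sosH_shift (Λ : Finset Site) (h : ℤ) (g : {x // x ∈ Λ} → ℤ) :
    sosH Λ (fun _ => h) (extendC Λ (fun _ => h) (g + fun _ => h)) = sosH Λ 0 (ex Λ g) := by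
  unfold sosH
  simp only [ext_shift, add_sub_add_right_eq_sub, add_sub_cancel_right, Pi.zero_apply, sub_zero]

lemma weight_shift (β : ℝ) (Λ : Finset Site) (F : Config → ℝ) (m h : ℕ) (g : {x // x ∈ Λ} → ℤ) :
    gWeight β Λ (fun _ => (h:ℤ)) (Set.Icc 0 ((m:ℤ) + h)) F
      (extendC Λ (fun _ => (h:ℤ)) (g + fun _ => (h:ℤ))) =
    if g ∈ Fintype.piFinset (fun _ : {x // x ∈ Λ} => Finset.Icc (-(h:ℤ)) (m:ℤ)) then
      mu β Λ g * Real.exp (F (extendC Λ (fun _ => (h:ℤ)) (g + fun _ => (h:ℤ)))) else 0 := by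
  unfold gWeight
  have hiff : (∀ x ∈ Λ, extendC Λ (fun _ => (h:ℤ)) (g + fun _ => (h:ℤ)) x ∈
      Set.Icc (0:ℤ) ((m:ℤ) + h)) ↔
      g ∈ Fintype.piFinset (fun _ : {x // x ∈ Λ} => Finset.Icc (-(h:ℤ)) (m:ℤ)) := by
    rw [Fintype.mem_piFinset]
    constructor
    · intro H x
      have := H x.1 x.2
      rw [ext_shift, ex_on Λ g x.1 x.2, Set.mem_Icc] at this
      have h8 : g ⟨x.1, x.2⟩ = g x := rfl
      rw [h8] at this
      rw [Finset.mem_Icc]; omega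
    · intro H x hx
      have := H ⟨x, hx⟩
      rw [Finset.mem_Icc] at this
      rw [ext_shift, ex_on Λ g x hx, Set.mem_Icc]; omega
  simp only [hiff]
  split_ifs
  · rw [sosH_shift, Real.exp_add]; rfl
  · rfl

lemma prob_bound (β : ℝ) (Λ : Finset Site) (F : Config → ℝ) (m h : ℕ) (A : Set Config)
    (Bad : ({x // x ∈ Λ} → ℤ) → Prop) (D ε : ℝ) (hF0 : ∀ η, 0 ≤ F η) (hF : ∀ η, F η ≤ D)
    (hA : ∀ g, extendC Λ (fun _ => (h:ℤ)) (g + fun _ => (h:ℤ)) ∉ A → Bad g)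
    (hb : ∑ g ∈ (Fintype.piFinset (fun _ : {x // x ∈ Λ} => Finset.Icc (-(h:ℤ)) (m:ℤ))).filter Bad,
      mu β Λ g ≤
      ε * ∑ g ∈ Fintype.piFinset (fun _ : {x // x ∈ Λ} => Finset.Icc (-(h:ℤ)) (m:ℤ)), mu β Λ g) :
    gProb β Λ (fun _ => (h:ℤ)) (Set.Icc 0 ((m:ℤ) + h)) F A ≤ 1 ∧
    1 - Real.exp D * ε ≤ gProb β Λ (fun _ => (h:ℤ)) (Set.Icc 0 ((m:ℤ) + h)) F A := by
  set C := Fintype.piFinset (fun _ : {x // x ∈ Λ} => Finset.Icc (-(h:ℤ)) (m:ℤ)) with hC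
  set e : ({x // x ∈ Λ} → ℤ) → Config := fun g =>
    extendC Λ (fun _ => (h:ℤ)) (g + fun _ => (h:ℤ)) with he
  have hw := weight_shift β Λ F m h
  have hden : ∑' g : {x // x ∈ Λ} → ℤ, gWeight β Λ (fun _ => (h:ℤ)) (Set.Icc 0 ((m:ℤ) + h)) F
      (extendC Λ (fun _ => (h:ℤ)) g) = ∑ g ∈ C, mu β Λ g * Real.exp (F (e g)) := by
    rw [← (Equiv.addRight (fun _ : {x // x ∈ Λ} => (h:ℤ))).tsum_eq]
    simp only [Equiv.coe_addRight, hw]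
    rw [tsum_eq_sum (s := C) (fun g hg => if_neg hg)]
    exact Finset.sum_congr rfl fun g hg => if_pos hg
  have hnum : ∑' g : {x // x ∈ Λ} → ℤ, Set.indicator A (gWeight β Λ (fun _ => (h:ℤ))
      (Set.Icc 0 ((m:ℤ) + h)) F) (extendC Λ (fun _ => (h:ℤ)) g) =
      ∑ g ∈ C.filter (fun g => e g ∈ A), mu β Λ g * Real.exp (F (e g)) := by
    rw [← (Equiv.addRight (fun _ : {x // x ∈ Λ} => (h:ℤ))).tsum_eq]
    simp only [Equiv.coe_addRight, Set.indicator_apply, hw]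
    rw [tsum_eq_sum (s := C) (fun g hg => by rw [if_neg hg]; simp), Finset.sum_filter]
    refine Finset.sum_congr rfl fun g hg => ?_
    rw [if_pos hg]
  unfold gProb
  rw [hnum, hden]
  have hpos : ∀ g, 0 < mu β Λ g * Real.exp (F (e g)) := fun g => mul_pos (mu_pos _ _ _) (Real.exp_pos _)
  have hCne : C.Nonempty := ⟨0, by
    rw [hC, Fintype.mem_piFinset]; intro x; rw [Finset.mem_Icc]; simp⟩
  have hD : 0 < ∑ g ∈ C, mu β Λ g * Real.exp (F (e g)) := Finset.sum_pos (fun g _ => hpos g) hCne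
  have hsplit := Finset.sum_filter_add_sum_filter_not C (fun g => e g ∈ A)
    (fun g => mu β Λ g * Real.exp (F (e g)))
  have hneg : 0 ≤ ∑ g ∈ C.filter (fun g => ¬ e g ∈ A), mu β Λ g * Real.exp (F (e g)) :=
    Finset.sum_nonneg fun g _ => (hpos g).le
  constructor
  · rw [div_le_one hD]; linarith
  · rw [le_div_iff₀ hD]
    have h1 : ∑ g ∈ C.filter (fun g => ¬ e g ∈ A), mu β Λ g * Real.exp (F (e g)) ≤
        Real.exp D * ∑ g ∈ C.filter Bad, mu β Λ g := by
      rw [Finset.mul_sum]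
      calc _ ≤ ∑ g ∈ C.filter Bad, mu β Λ g * Real.exp (F (e g)) := by
            apply Finset.sum_le_sum_of_subset_of_nonneg
            · intro g hg
              rw [Finset.mem_filter] at hg ⊢
              exact ⟨hg.1, hA g hg.2⟩
            · intro g _ _; exact (hpos g).le
        _ ≤ _ := by
            refine Finset.sum_le_sum fun g _ => ?_
            rw [mul_comm]
            exact mul_le_mul_of_nonneg_right (Real.exp_le_exp.2 (hF _)) (mu_pos _ _ _).le
    have h2 : ∑ g ∈ C, mu β Λ g ≤ ∑ g ∈ C, mu β Λ g * Real.exp (F (e g)) :=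
      Finset.sum_le_sum fun g _ => le_mul_of_one_le_right (mu_pos _ _ _).le (Real.one_le_exp (hF0 _))
    have h0 : 0 < ∑ g ∈ C, mu β Λ g := Finset.sum_pos (fun g _ => mu_pos _ _ _) hCne
    have hε : 0 ≤ ε := by
      have : 0 ≤ ∑ g ∈ C.filter Bad, mu β Λ g := Finset.sum_nonneg fun g _ => (mu_pos _ _ _).le
      by_contra hc
      push Not at hc
      nlinarith
    have h3 := mul_le_mul_of_nonneg_left hb (Real.exp_nonneg D)
    have h4 := mul_le_mul_of_nonneg_left h2 (mul_nonneg (Real.exp_nonneg D) hε)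
    linarith

lemma bad_bound2 {Λ : Finset Site} {M : ℤ} (hM : Bd Λ M) (hΛ : VRay Λ) (β : ℝ) (hβ : 100 ≤ β)
    (m h : ℕ)
    (hsmall : Λ.card * (4 * Real.exp (-(4 * β * (m + 1)))) ≤ 1/2)
    (hp : 4 * Real.exp (-(4 * β * (h + 1))) ≤ 1) (I : Finset ℕ) (R : ℕ → Finset Site)
    (hR : ∀ i, Set.InjOn Prod.snd (R i : Set Site)) (r : ℕ) (hr : ∀ i, (R i).card ≤ r) (t : ℝ)
    (Bad : ({x // x ∈ Λ} → ℤ) → Prop) (hBad : ∀ g, Bad g → ∃ i ∈ I, t ≤ Phi (R i) (ex Λ g)) :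
    (1 - 4 * Real.exp (-(4 * β * (h + 1)))) ^ Λ.card *
      (∑ g ∈ (Fintype.piFinset (fun _ : {x // x ∈ Λ} => Finset.Icc (-(h:ℤ)) (m:ℤ))).filter Bad,
        mu β Λ g) ≤
      I.card * Real.exp (-t) * 2 ^ r *
      (2 * ∑ g ∈ Fintype.piFinset (fun _ : {x // x ∈ Λ} => Finset.Icc (-(h:ℤ)) (m:ℤ)), mu β Λ g) := by
  refine le_trans ?_ (bad_bound hM hΛ β hβ m h hsmall hp I R hR r hr t)
  refine mul_le_mul_of_nonneg_left ?_ (pow_nonneg (sub_nonneg.2 hp) Λ.card)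
  apply Finset.sum_le_sum_of_subset_of_nonneg
  · intro g hg
    rw [Finset.mem_filter] at hg ⊢
    exact ⟨hg.1, hBad g hg.2⟩
  · intro g _ _; exact (mu_pos _ _ _).le

lemma num_aux (L : ℕ) (X Y P c e : ℝ) (hX0 : 0 ≤ X) (hY0 : 0 ≤ Y) (hc : c ≤ 2 * L)
    (hP : Real.exp (-(16 * L)) ≤ P) (h : P * X ≤ c * Real.exp e * 2 ^ L * (2 * Y)) :
    X ≤ Real.exp (16 * L) * ((2 * L) * Real.exp e * 2 ^ L * 2) * Y := by
  have b1 := (mul_le_mul_of_nonneg_right hP hX0).trans h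
  have b0 : 0 ≤ Real.exp e * 2 ^ L * (2 * Y) := by positivity
  have b3 := mul_le_mul_of_nonneg_right hc b0
  have b5 : Real.exp (-(16 * L)) * X ≤ (2 * L) * (Real.exp e * 2 ^ L * (2 * Y)) := by linarith
  have b4 := mul_le_mul_of_nonneg_left b5 (Real.exp_nonneg (16 * L))
  rw [← mul_assoc, ← Real.exp_add, add_neg_cancel, Real.exp_zero, one_mul] at b4
  linarith

lemma main_bound (β : ℝ) (hβ : 100 ≤ β) (ℓ : ℝ) (hℓ : 100 ≤ ℓ) (L : ℕ) (hL : 10 ≤ Real.log L) :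
    gProb β (rect2 L) (fun _ => eqHt β L + 1) (Set.Icc 0 (ceilN L))
            (fieldF β L (rect2 L)) (Gplus β L ℓ) ≤ 1 ∧
    1 - 4 / (L:ℝ) ≤ gProb β (rect2 L) (fun _ => eqHt β L + 1) (Set.Icc 0 (ceilN L))
            (fieldF β L (rect2 L)) (Gplus β L ℓ) := by
  have hL0 : 0 < L := by
    rcases Nat.eq_zero_or_pos L with h | h
    · subst h; simp at hL; linarith
    · exact h
  have hLr : (0:ℝ) < L := by exact_mod_cast hL0
  have hexpL : Real.exp (Real.log L) = L := Real.exp_log hLr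
  have hL8 : (11:ℝ) ≤ L := by
    rw [← hexpL]
    have := Real.add_one_le_exp (Real.log L)
    linarith
  -- integers
  set lg := Real.log L with hlg
  have hH0 : 0 ≤ eqHt β L := Int.floor_nonneg.2 (by positivity)
  have hH1 : (eqHt β L : ℝ) ≤ lg / (4 * β) := Int.floor_le _
  have hH2 : lg / (4 * β) < eqHt β L + 1 := Int.lt_floor_add_one _
  have hH3 : lg / (4 * β) ≤ lg / 400 := by
    apply div_le_div_of_nonneg_left <;> linarith
  have hn1 : lg < ceilN L + 1 := Int.lt_floor_add_one _
  have hmR : (0:ℝ) < ceilN L - (eqHt β L + 1) := by linarith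
  have hm0 : 0 < ceilN L - (eqHt β L + 1) := by exact_mod_cast hmR
  obtain ⟨h, hh⟩ := Int.eq_ofNat_of_zero_le (show 0 ≤ eqHt β L + 1 by omega)
  obtain ⟨m, hm⟩ := Int.eq_ofNat_of_zero_le hm0.le
  have hceil : ceilN L = (m:ℤ) + h := by omega
  have hhR : (h:ℝ) = eqHt β L + 1 := by exact_mod_cast hh.symm
  have hmR' : (m:ℝ) = ceilN L - (eqHt β L + 1) := by exact_mod_cast hm.symm
  have hq : Real.exp (-(4 * β * (h + 1))) ≤ 1 / L := by
    rw [one_div, ← hexpL, ← Real.exp_neg]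
    apply Real.exp_le_exp.2
    rw [div_lt_iff₀ (by linarith), ← hhR] at hH2
    nlinarith
  set q := Real.exp (-(4 * β * (h + 1))) with hqdef
  have hq0 : 0 < q := Real.exp_pos _
  have h4L : 4 * (1 / (L:ℝ)) ≤ 1/2 := by
    rw [mul_one_div, div_le_iff₀ hLr]; linarith
  have hsmall : ((rect2 L).card : ℝ) * (4 * Real.exp (-(4 * β * (m + 1)))) ≤ 1/2 := by
    have e1 : Real.exp (-(4 * β * (m + 1))) ≤ Real.exp (-(5 * lg)) := by
      apply Real.exp_le_exp.2
      have : lg / 2 ≤ (m:ℝ) + 1 := by linarith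
      nlinarith
    have e2 : Real.exp (-(5 * lg)) = ((L:ℝ)^5)⁻¹ := by
      rw [Real.exp_neg, ← hexpL, ← Real.exp_nat_mul]; norm_num
    rw [rect_card]
    push_cast
    have e3 : 2 * (L:ℝ) * L * (4 * ((L:ℝ)^5)⁻¹) ≤ 1/2 := by
      have : 2 * (L:ℝ) * L * (4 * ((L:ℝ)^5)⁻¹) = 8 / (L:ℝ)^3 := by field_simp; ring
      rw [this, div_le_iff₀ (by positivity)]
      have : (11:ℝ)^3 ≤ (L:ℝ)^3 := by gcongr
      linarith
    rw [e2] at e1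
    exact le_trans (by gcongr) e3
  obtain ⟨Bad, hBad⟩ : ∃ Bad : ({x // x ∈ rect2 L} → ℤ) → Prop, ∀ g, Bad g ↔
    ∃ i ∈ Finset.Icc 1 (2 * L - 1), L * ℓ - L ≤ Phi (diagR L i) (ex (rect2 L) g) :=
    ⟨_, fun _ => Iff.rfl⟩
  have hbad := bad_bound2 (rect_bd L) (rect_vray L) β hβ m h hsmall (by linarith)
    (Finset.Icc 1 (2 * L - 1)) (diagR L) (diag_inj L) L (diag_card L) (L * ℓ - L) Bad (fun g => (hBad g).1)
  -- power
  have hpow : Real.exp (-(16 * L)) ≤ (1 - 4 * q) ^ (rect2 L).card := by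
    have a1 : Real.exp (-(8 / (L:ℝ))) ≤ 1 - 4 * q := by
      have b1 := Real.add_one_le_exp (8 / (L:ℝ))
      rw [Real.exp_neg, inv_le_comm₀ (Real.exp_pos _) (by linarith)]
      refine le_trans ?_ b1
      rw [inv_le_iff_one_le_mul₀ (by linarith)]
      have b2 : 1 - 4 / (L:ℝ) ≤ 1 - 4 * q := by
        have : 4 / (L:ℝ) = 4 * (1 / L) := by ring
        linarith
      have b3 : 0 < 8 / (L:ℝ) := by positivity
      have b4 : 8 / (L:ℝ) = 8 * (1/L) := by ring
      have b5 : 4 / (L:ℝ) = 4 * (1/L) := by ring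
      have b6 : 0 < 1 / (L:ℝ) := by positivity
      rw [b4]
      rw [b5] at b2
      nlinarith
    calc Real.exp (-(16 * L)) = Real.exp (-(8 / (L:ℝ))) ^ (rect2 L).card := by
          rw [← Real.exp_nat_mul, rect_card]; congr 1; push_cast; field_simp; ring
      _ ≤ _ := by gcongr
  have hcard : ((Finset.Icc 1 (2 * L - 1)).card : ℝ) ≤ 2 * L := by
    rw [Nat.card_Icc]
    have : 2 * L - 1 + 1 - 1 ≤ 2 * L := by omega
    exact_mod_cast this
  have hXY := num_aux L _ _ _ _ _ (Finset.sum_nonneg fun g _ => (mu_pos _ _ _).le)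
    (Finset.sum_nonneg fun g _ => (mu_pos _ _ _).le) hcard hpow hbad
  have hfin := prob_bound β (rect2 L) (fieldF β L (rect2 L)) m h (Gplus β L ℓ) Bad
    (2 * L) _ (field_nonneg β L _) (field_le β hβ L hL0) (by
      intro g hg
      simp only [Gplus, Set.mem_ofPred_eq] at hg
      push Not at hg
      obtain ⟨i, hi, hlt⟩ := hg
      refine (hBad g).2 ⟨i, hi, ?_⟩
      have c1 : ∑ x ∈ diagR L i, max (extendC (rect2 L) (fun _ => (h:ℤ)) (g + fun _ => (h:ℤ)) x -
          eqHt β L) 0 ≤ Phi (diagR L i) (ex (rect2 L) g) + L := by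
        have c2 := diag_card L i
        calc _ ≤ ∑ x ∈ diagR L i, (max (ex (rect2 L) g x) 0 + 1) := by
              refine Finset.sum_le_sum fun x _ => ?_
              rw [ext_shift]; omega
          _ = Phi (diagR L i) (ex (rect2 L) g) + (diagR L i).card := by
              rw [Finset.sum_add_distrib]; simp [Phi]
          _ ≤ _ := by omega
      have c3 : ((∑ x ∈ diagR L i, max (extendC (rect2 L) (fun _ => (h:ℤ)) (g + fun _ => (h:ℤ)) x -
          eqHt β L) 0 : ℤ) : ℝ) ≤ Phi (diagR L i) (ex (rect2 L) g) + L := by exact_mod_cast c1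
      linarith) hXY
  rw [hh, hceil]
  refine ⟨hfin.1, le_trans ?_ hfin.2⟩
  have d1 : (2:ℝ) ^ L ≤ Real.exp L := by
    have := Real.add_one_le_exp (1:ℝ)
    calc (2:ℝ)^L ≤ (Real.exp 1) ^ L := by gcongr; linarith
      _ = _ := by rw [← Real.exp_nat_mul, mul_one]
  have d2 : Real.exp (-(L * ℓ - L)) ≤ Real.exp (-(99 * L)) := by
    apply Real.exp_le_exp.2; nlinarith
  have d3 : (L:ℝ) ≤ Real.exp L := by
    have := Real.add_one_le_exp (L:ℝ); linarith
  have d4 : Real.exp (2 * L) * (Real.exp (16 * L) * ((2 * L) * Real.exp (-(L * ℓ - L)) * 2 ^ L * 2)) ≤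
      Real.exp (2 * L) * (Real.exp (16 * L) * ((2 * Real.exp L) * Real.exp (-(99 * L)) *
        Real.exp L * 2)) := by
    gcongr
  have d5 : Real.exp (2 * L) * (Real.exp (16 * L) * ((2 * Real.exp L) * Real.exp (-(99 * L)) *
        Real.exp L * 2)) = 4 * Real.exp (2 * L + 16 * L + L + -(99 * L) + L) := by
    simp only [Real.exp_add]; ring
  have d6 : Real.exp (2 * L + 16 * L + L + -(99 * L) + L) ≤ (L:ℝ)⁻¹ := by
    calc _ ≤ Real.exp (-L) := Real.exp_le_exp.2 (by linarith)
      _ = (Real.exp L)⁻¹ := Real.exp_neg _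
      _ ≤ _ := by gcongr
  rw [d5] at d4
  have d7 : 4 / (L:ℝ) = 4 * (L:ℝ)⁻¹ := by ring
  linarith

/-- Lemma 5.10 of the paper. Let `Λ` be the `2L × L` rectangle
obtained by attaching a side-`L` square to the left of `Λ_L`, let `H' = H(L)+1`, and
let `π_Λ^{H',f}` be the SOS measure on `Λ` with constant boundary condition `H'`, floor
at `0`, ceiling at `n⁺ = ⌊log L⌋` and field `f`. Then for `β` and `ℓ` sufficiently
large, `π_Λ^{H',f}(η|_{Λ_L} ∈ G⁺_ℓ) → 1` as `L → ∞`. -/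
theorem sos_equilibrium_Gplus :
    ∃ β₀ ℓ₀ : ℝ, ∀ β : ℝ, β₀ ≤ β → ∀ ℓ : ℝ, ℓ₀ ≤ ℓ →
      Filter.Tendsto
        (fun L : ℕ =>
          gProb β (rect2 L) (fun _ => eqHt β L + 1) (Set.Icc 0 (ceilN L))
            (fieldF β L (rect2 L)) (Gplus β L ℓ))
        Filter.atTop (nhds 1) := by
  refine ⟨100, 100, fun β hβ ℓ hℓ => ?_⟩
  have hlog : ∀ᶠ L : ℕ in Filter.atTop, 10 ≤ Real.log L :=
    (Real.tendsto_log_atTop.comp tendsto_natCast_atTop_atTop).eventually_ge_atTop 10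
  have hlow : Filter.Tendsto (fun L : ℕ => 1 - 4 / (L:ℝ)) Filter.atTop (nhds 1) := by
    have := (tendsto_const_div_atTop_nhds_zero_nat (4:ℝ)).const_sub 1
    simpa using this
  refine tendsto_of_tendsto_of_tendsto_of_le_of_le' hlow tendsto_const_nhds ?_ ?_
  · filter_upwards [hlog] with L hL using (main_bound β hβ ℓ hℓ L hL).2
  · filter_upwards [hlog] with L hL using (main_bound β hβ ℓ hℓ L hL).1

end SOSPaper
end
end

section
/- For a height configuration η on ℤ² equal to 0 outside a finite connected set Λ ⊂ ℤ², let S(η) be the set of dual-lattice bonds e' such that the gradient of η across the edge of ℤ² crossed by e' is nonzero. There exists β₀ > 0 such that for all β ≥ β₀, all finite connected Λ ⊂ ℤ², and all sets V of dual bonds: π̂_Λ^0( S(η) ⊇ V ) ≤ e^{−(β−β₀)·|V|}. -/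
open scoped Classical
open Filter

noncomputable section

namespace SOSPaper

/-- A finite subset of `ℤ²` is connected (for nearest-neighbour adjacency). -/
def FinsetConn (Λ : Finset Site) : Prop :=
  ∀ x ∈ Λ, ∀ y ∈ Λ, ∃ l : List Site, l.head? = some x ∧ l.getLast? = some y ∧
    (∀ z ∈ l, z ∈ Λ) ∧ l.Chain' SiteAdj

open scoped ENNReal

lemma tsum_pi_fin {β : Type} : ∀ (n : ℕ) (f : Fin n → β → ℝ≥0∞),
    ∑' m : Fin n → β, ∏ i, f i (m i) = ∏ i, ∑' b, f i b := by
  intro n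
  induction n with
  | zero => intro f; simp [tsum_fintype]
  | succ n ih =>
    intro f
    rw [← (Fin.consEquiv (fun _ : Fin (n+1) => β)).tsum_eq, ENNReal.tsum_prod', Fin.prod_univ_succ, ← ih,
      ← ENNReal.tsum_mul_right]
    congr 1; ext b
    rw [← ENNReal.tsum_mul_left]
    congr 1; ext m
    simp [Fin.consEquiv, Fin.prod_univ_succ]

lemma tsum_pi {β ι : Type} [Fintype ι] (f : ι → β → ℝ≥0∞) :
    ∑' m : ι → β, ∏ i, f i (m i) = ∏ i, ∑' b, f i b := by
  let e := Fintype.equivFin ι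
  rw [← (Equiv.arrowCongr e.symm (Equiv.refl β)).tsum_eq, ← e.symm.prod_comp, ← tsum_pi_fin]
  congr 1; ext m
  rw [← e.symm.prod_comp]
  simp [Equiv.arrowCongr]

def gg (r : ℝ≥0∞) (m : ℤ) : ℝ≥0∞ := if 0 ≤ m then r ^ m.toNat else 0

lemma tsum_int (F : ℤ → ℝ≥0∞) :
    ∑' n, F n = ∑' n : ℕ, F n + ∑' n : ℕ, F (-(n+1 : ℤ)) :=
  tsum_of_nat_of_neg_add_one ENNReal.summable ENNReal.summable

lemma gg_conv_nat (r : ℝ≥0∞) (n : ℕ) :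
    ∑' m, gg r m * gg r (m + n) = r ^ n * ∑' k : ℕ, (r^2)^k := by
  rw [tsum_int, ← ENNReal.tsum_mul_left]
  have h2 : ∑' k : ℕ, gg r (-(k+1 : ℤ)) * gg r (-(k+1 : ℤ) + n) = 0 := by
    rw [ENNReal.tsum_eq_zero]
    intro k
    have : ¬ (0:ℤ) ≤ -(k+1 : ℤ) := by omega
    rw [gg, if_neg this, zero_mul]
  rw [h2, add_zero]
  congr 1; ext k
  have h1 : (0:ℤ) ≤ (k:ℤ) := by omega
  have h3 : (0:ℤ) ≤ (k:ℤ) + n := by omega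
  have h4 : ((k:ℤ) + n).toNat = k + n := by omega
  simp only [gg, h1, h3, h4, if_true, Int.toNat_natCast]
  ring

lemma gg_conv (r : ℝ≥0∞) (n : ℤ) :
    ∑' m, gg r m * gg r (m + n) = r ^ n.natAbs * ∑' k : ℕ, (r^2)^k := by
  rcases Int.natAbs_eq n with h | h
  · conv_lhs => rw [h]
    exact gg_conv_nat r _
  · rw [← gg_conv_nat, ← (Equiv.addRight (n.natAbs:ℤ)).tsum_eq]
    congr 1; ext m
    have : m + (n.natAbs:ℤ) + n = m := by omega
    simp only [Equiv.coe_addRight, this]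
    ring

lemma amgm (a b : ℝ≥0∞) : 2 * (a * b) ≤ a * a + b * b := by
  rcases eq_or_ne a ⊤ with rfl | ha
  · simp
  rcases eq_or_ne b ⊤ with rfl | hb
  · simp
  lift a to NNReal using ha
  lift b to NNReal using hb
  have : 2 * (a * b) ≤ a * a + b * b := by
    rw [← NNReal.coe_le_coe]
    push_cast
    nlinarith [sq_nonneg ((a:ℝ) - b)]
  exact_mod_cast this

section dom
variable {A ι : Type} [AddCommGroup A] (d : A →+ (ι → ℤ)) (hd : Function.Injective d)

lemma tsum_coset (hd : Function.Injective d) (F : (ι → ℤ) → ℝ≥0∞) :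
    ∑' m, F m = ∑' q : (ι → ℤ) ⧸ d.range, ∑' x : A, F (q.out + d x) := by
  rw [← ENNReal.tsum_prod (f := fun (q : (ι → ℤ) ⧸ d.range) (x : A) => F (q.out + d x))]
  have hb : Function.Bijective
      (fun p : ((ι → ℤ) ⧸ d.range) × A => p.1.out + d p.2) := by
    constructor
    · rintro ⟨q, x⟩ ⟨q', x'⟩ h
      simp only at h
      have hq : q = q' := by
        have := congrArg (QuotientAddGroup.mk (s := d.range)) h
        have h0 : ∀ x, (QuotientAddGroup.mk (d x) : (ι → ℤ) ⧸ d.range) = 0 := fun x =>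
          (QuotientAddGroup.eq_zero_iff _).2 ⟨x, rfl⟩
        simpa [QuotientAddGroup.mk_add, h0] using this
      subst hq
      have := hd (add_left_cancel h)
      rw [this]
    · intro m
      have : (QuotientAddGroup.mk (Quotient.out (QuotientAddGroup.mk m : (ι → ℤ) ⧸ d.range)) : (ι → ℤ) ⧸ d.range)
         = QuotientAddGroup.mk m := by simp
      rw [QuotientAddGroup.eq] at this
      obtain ⟨x, hx⟩ := this
      refine ⟨(QuotientAddGroup.mk m, x), ?_⟩
      simp only [hx]
      abel
  rw [← (Equiv.ofBijective _ hb).tsum_eq]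
  rfl

lemma dom0 (hd : Function.Injective d) (G : (ι → ℤ) → ℝ≥0∞) (a : ι → ℤ) :
    ∑' x, ∑' m, G m * G (m + (d x - a)) ≤ ∑' x, ∑' m, G m * G (m + d x) := by
  let P : (ι → ℤ) → ℝ≥0∞ := fun m => ∑' x, G (m + d x)
  have hP : ∀ m x, P (m + d x) = P m := by
    intro m x
    simp only [P]
    rw [← (Equiv.addLeft x).tsum_eq (fun y => G (m + d y))]
    congr 1; ext y
    simp [add_assoc]
  have key : ∀ a, ∑' x, ∑' m, G m * G (m + (d x - a)) =
      ∑' q : (ι → ℤ) ⧸ d.range, P q.out * P (q.out - a) := by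
    intro a
    rw [ENNReal.tsum_comm]
    have : ∀ m, ∑' x, G m * G (m + (d x - a)) = G m * P (m - a) := by
      intro m
      rw [ENNReal.tsum_mul_left]
      congr 2; ext x; congr 1; abel
    simp_rw [this]
    rw [tsum_coset d hd]
    congr 1; ext q
    rw [← ENNReal.tsum_mul_right]
    congr 1; ext x
    rw [← hP (q.out - a) x]
    congr 2; abel
  have k0 := key 0
  simp only [sub_zero] at k0
  rw [key a, k0]
  have hsh : ∑' q : (ι → ℤ) ⧸ d.range, P (q.out - a) * P (q.out - a)
      = ∑' q : (ι → ℤ) ⧸ d.range, P q.out * P q.out := by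
    rw [← (Equiv.subRight (QuotientAddGroup.mk a : (ι → ℤ) ⧸ d.range)).tsum_eq
      (fun q => P q.out * P q.out)]
    congr 1; ext q
    have : P (q.out - a) = P ((q - QuotientAddGroup.mk a : (ι → ℤ) ⧸ d.range).out) := by
      have : (QuotientAddGroup.mk (q.out - a) : (ι → ℤ) ⧸ d.range)
         = QuotientAddGroup.mk ((q - QuotientAddGroup.mk a : (ι → ℤ) ⧸ d.range).out) := by
        simp [QuotientAddGroup.mk_sub]
      rw [QuotientAddGroup.eq] at this
      obtain ⟨x, hx⟩ := this
      rw [← hP _ x, hx]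
      congr 1; abel
    simp [this]
  have h2 : 2 * ∑' q : (ι → ℤ) ⧸ d.range, P q.out * P (q.out - a) ≤
      2 * ∑' q : (ι → ℤ) ⧸ d.range, P q.out * P q.out := by
    conv_rhs => rw [two_mul]
    nth_rw 2 [← hsh]
    rw [← ENNReal.tsum_add, ← ENNReal.tsum_mul_left]
    refine ENNReal.tsum_le_tsum fun q => ?_
    exact amgm _ _
  exact (ENNReal.mul_le_mul_iff_right (by simp) (by simp)).1 h2

lemma dom [Fintype ι] (hd : Function.Injective d) (r : ι → ℝ≥0∞) (hr : ∀ i, r i < 1) (a : ι → ℤ) :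
    ∑' x, ∏ i, (r i) ^ (d x i - a i).natAbs ≤ ∑' x, ∏ i, (r i) ^ (d x i).natAbs := by
  let C : ℝ≥0∞ := ∏ i, ∑' k : ℕ, ((r i)^2)^k
  have hC0 : C ≠ 0 := by
    refine Finset.prod_ne_zero_iff.2 fun i _ => ?_
    rw [ENNReal.tsum_geometric]
    exact ENNReal.inv_ne_zero.2 (ne_top_of_le_ne_top ENNReal.one_ne_top tsub_le_self)
  have hCt : C ≠ ⊤ := by
    refine ENNReal.prod_ne_top fun i _ => ?_
    rw [ENNReal.tsum_geometric]
    refine ENNReal.inv_ne_top.2 ?_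
    have : (r i)^2 < 1 := pow_lt_one₀ (zero_le) (hr i) (by norm_num)
    exact (tsub_pos_of_lt this).ne'
  have key : ∀ n : ι → ℤ, (∏ i, (r i) ^ (n i).natAbs) * C =
      ∑' m : ι → ℤ, (∏ i, gg (r i) (m i)) * ∏ i, gg (r i) ((m + n) i) := by
    intro n
    simp_rw [← Finset.prod_mul_distrib, Pi.add_apply]
    rw [tsum_pi (fun i k => gg (r i) k * gg (r i) (k + n i)), ← Finset.prod_mul_distrib]
    exact Finset.prod_congr rfl fun i _ => (gg_conv _ _).symm
  have := dom0 d hd (fun m => ∏ i, gg (r i) (m i)) a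
  simp only [← key] at this
  rw [ENNReal.tsum_mul_right, ENNReal.tsum_mul_right] at this
  exact (ENNReal.mul_le_mul_iff_left hC0 hCt).1 this
end dom

lemma tsum_ne_zero_le (q : ℝ≥0∞) (hq : q ≤ 1/4) :
    ∑' n : ℤ, (if n = 0 then 0 else q ^ n.natAbs) ≤ 4 * q := by
  have hg : ∑' n : ℕ, q ^ (n+1) ≤ 2 * q := by
    simp_rw [pow_succ]
    rw [ENNReal.tsum_mul_right, ENNReal.tsum_geometric]
    gcongr
    rw [ENNReal.inv_le_iff_inv_le]
    refine le_trans ?_ (tsub_le_tsub_left (hq.trans (?_ : (1/4:ℝ≥0∞) ≤ 2⁻¹)) 1)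
    · rw [ENNReal.one_sub_inv_two]
    · rw [one_div]; exact ENNReal.inv_le_inv.2 (by norm_num)
  rw [tsum_int]
  have h1 : ∑' n : ℕ, (if (n:ℤ) = 0 then 0 else q ^ (n:ℤ).natAbs) = ∑' n : ℕ, q ^ (n+1) := by
    rw [tsum_eq_zero_add' ENNReal.summable]
    simp
    rfl
  have h2 : ∑' n : ℕ, (if (-(n+1:ℤ)) = 0 then 0 else q ^ (-(n+1:ℤ)).natAbs) = ∑' n : ℕ, q ^ (n+1) := by
    congr 1
  rw [h1, h2]
  calc _ ≤ 2 * q + 2 * q := add_le_add hg hg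
    _ = 4 * q := by ring

/-- abstract Peierls -/
lemma peierls {A ι : Type} [AddCommGroup A] [Fintype ι] (d : A →+ (ι → ℤ))
    (hd : Function.Injective d) (V : Finset ι) (q : ℝ≥0∞) (hq : q ≤ 1/4) :
    ∑' x, (if ∀ i ∈ V, d x i ≠ 0 then ∏ i, q ^ (d x i).natAbs else 0) ≤
      (4 * q) ^ V.card * ∑' x, ∏ i, q ^ (d x i).natAbs := by
  have hq1 : q < 1 := hq.trans_lt (by rw [one_div]; exact ENNReal.inv_lt_one.2 (by norm_num))
  let r : ι → ℝ≥0∞ := fun i => if i ∈ V then 0 else q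
  have hr : ∀ i, r i < 1 := fun i => by simp only [r]; split_ifs <;> simp [hq1]
  let φ : ℤ → ℝ≥0∞ := fun n => if n = 0 then 0 else q ^ n.natAbs
  let ext : (V → ℤ) → ι → ℤ := fun a i => if h : i ∈ V then a ⟨i, h⟩ else 0
  have hWZ : ∑' x, ∏ i, (r i) ^ (d x i).natAbs ≤ ∑' x, ∏ i, q ^ (d x i).natAbs := by
    refine ENNReal.tsum_le_tsum fun x => Finset.prod_le_prod' fun i _ => ?_
    refine pow_le_pow_left' ?_ _
    simp only [r]; split_ifs <;> simp
  calc _ ≤ ∑' x, ∑' a : V → ℤ, (∏ i, φ (a i)) * ∏ i, (r i) ^ (d x i - ext a i).natAbs := by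
        refine ENNReal.tsum_le_tsum fun x => ?_
        split_ifs with hx
        · refine le_trans ?_ (ENNReal.le_tsum (fun i : V => d x i))
          apply le_of_eq
          rw [Finset.prod_coe_sort V (fun i => φ (d x i)), ← Finset.prod_mul_prod_compl V,
            ← Finset.prod_mul_prod_compl V (fun i => (r i) ^ _), ← mul_assoc,
            ← Finset.prod_mul_distrib]
          congr 1
          · refine Finset.prod_congr rfl fun i hi => ?_
            simp [φ, ext, r, hi, hx i hi]
          · refine Finset.prod_congr rfl fun i hi => ?_
            have hi : i ∉ V := by simpa using hi
            simp [ext, r, hi]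
        · exact zero_le
    _ = ∑' a : V → ℤ, (∏ i, φ (a i)) * ∑' x, ∏ i, (r i) ^ (d x i - ext a i).natAbs := by
        rw [ENNReal.tsum_comm]; simp_rw [ENNReal.tsum_mul_left]
    _ ≤ ∑' a : V → ℤ, (∏ i, φ (a i)) * ∑' x, ∏ i, q ^ (d x i).natAbs := by
        refine ENNReal.tsum_le_tsum fun a => ?_
        exact mul_le_mul' le_rfl ((dom d hd r hr (ext a)).trans hWZ)
    _ = (∑' n, φ n) ^ V.card * ∑' x, ∏ i, q ^ (d x i).natAbs := by
        rw [ENNReal.tsum_mul_right, tsum_pi (fun _ => φ)]; simp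
    _ ≤ _ := by
        gcongr
        exact tsum_ne_zero_le q hq

lemma dir_sum (Λ : Finset Site) (e : Site) (η : Config) (h0 : ∀ x, x ∉ Λ → η x = 0)
    (B : Finset Site) (hB1 : Λ ⊆ B) (hB2 : ∀ x ∈ Λ, x - e ∈ B) :
    ∑ x ∈ Λ, (if x + e ∈ Λ then (1/2:ℝ) else 1) * ((|η x - η (x+e)| : ℤ) : ℝ) +
    ∑ x ∈ Λ, (if x - e ∈ Λ then (1/2:ℝ) else 1) * ((|η x - η (x-e)| : ℤ) : ℝ) =
    ∑ x ∈ B, ((|η (x+e) - η x| : ℤ) : ℝ) := by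
  have h1 : ∑ x ∈ Λ, (if x + e ∈ Λ then (1/2:ℝ) else 1) * ((|η x - η (x+e)| : ℤ) : ℝ) =
      ∑ x ∈ B, if x ∈ Λ then
        (if x + e ∈ Λ then (1/2:ℝ) else 1) * ((|η x - η (x+e)| : ℤ) : ℝ) else 0 := by
    rw [← Finset.sum_filter]
    refine Finset.sum_congr ?_ fun _ _ => rfl
    ext x; simp; exact fun h => hB1 h
  have h2 : ∑ x ∈ Λ, (if x - e ∈ Λ then (1/2:ℝ) else 1) * ((|η x - η (x-e)| : ℤ) : ℝ) =
      ∑ x ∈ B, if x + e ∈ Λ then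
        (if x ∈ Λ then (1/2:ℝ) else 1) * ((|η (x+e) - η x| : ℤ) : ℝ) else 0 := by
    rw [← Finset.sum_filter]
    refine Finset.sum_bij' (fun x _ => x - e) (fun x _ => x + e) ?_ ?_ ?_ ?_ ?_
    · intro x hx; simp [hx, hB2 x hx]
    · intro x hx; exact (Finset.mem_filter.1 hx).2
    · intro x hx; simp
    · intro x hx; simp
    · intro x hx; simp
  rw [h1, h2, ← Finset.sum_add_distrib]
  refine Finset.sum_congr rfl fun x _ => ?_
  rw [abs_sub_comm (η x)]
  by_cases hx : x ∈ Λ <;> by_cases hy : x + e ∈ Λ <;> simp only [hx, hy, if_true, if_false]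
  · ring
  · ring
  · ring
  · rw [h0 _ hx, h0 _ hy]; simp

/-- base points of edges -/
def baseB (Λ : Finset Site) : Finset Site :=
  Λ ∪ Λ.image (fun x => x - (1,0)) ∪ Λ.image (fun x => x - (0,1))

/-- edges -/
def edgeE (Λ : Finset Site) : Finset (Site × Site) :=
  (baseB Λ).image (fun x => (x, x + (1,0))) ∪ (baseB Λ).image (fun x => (x, x + (0,1)))

lemma sum_edgeE (Λ : Finset Site) (f : Site × Site → ℝ) :
    ∑ p ∈ edgeE Λ, f p = ∑ x ∈ baseB Λ, f (x, x + (1,0)) + ∑ x ∈ baseB Λ, f (x, x + (0,1)) := by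
  rw [edgeE, Finset.sum_union, Finset.sum_image, Finset.sum_image]
  · intro x _ y _ h; exact (Prod.mk.inj h).1
  · intro x _ y _ h; exact (Prod.mk.inj h).1
  · rw [Finset.disjoint_left]
    intro p hp hq
    simp only [Finset.mem_image] at hp hq
    obtain ⟨x, _, rfl⟩ := hp
    obtain ⟨y, _, h⟩ := hq
    have h1 := (Prod.mk.inj h).1
    have h2 := (Prod.mk.inj h).2
    rw [h1] at h2
    have := add_left_cancel h2
    simp at this

lemma sosH_eq (Λ : Finset Site) (η : Config) (h0 : ∀ x, x ∉ Λ → η x = 0) :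
    sosH Λ 0 η = ∑ p ∈ edgeE Λ, ((|η p.2 - η p.1| : ℤ) : ℝ) := by
  rw [sum_edgeE]
  dsimp only
  rw [← dir_sum Λ (1,0) η h0 (baseB Λ) (by intro x; simp +contextual [baseB])
      (by intro x hx; simp only [baseB, Finset.mem_union, Finset.mem_image]; exact Or.inl (Or.inr ⟨x, hx, rfl⟩)),
    ← dir_sum Λ (0,1) η h0 (baseB Λ) (by intro x; simp +contextual [baseB])
      (by intro x hx; simp only [baseB, Finset.mem_union, Finset.mem_image]; exact Or.inr ⟨x, hx, rfl⟩)]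
  rw [sosH, Finset.mul_sum]
  simp_rw [← Finset.sum_add_distrib]
  refine Finset.sum_congr rfl fun x _ => ?_
  have : (1/2:ℝ) * ∑ y ∈ (nbrs x).filter (fun y => y ∈ Λ), ((|η x - η y| : ℤ) : ℝ) +
      ∑ y ∈ (nbrs x).filter (fun y => y ∉ Λ), ((|η x - (0:Config) y| : ℤ) : ℝ) =
      ∑ y ∈ nbrs x, (if y ∈ Λ then (1/2:ℝ) else 1) * ((|η x - η y| : ℤ) : ℝ) := by
    rw [Finset.mul_sum, Finset.sum_filter, Finset.sum_filter, ← Finset.sum_add_distrib]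
    refine Finset.sum_congr rfl fun y _ => ?_
    by_cases hy : y ∈ Λ <;> simp [hy, h0]
  rw [this, nbrs]
  obtain ⟨u, v⟩ := x
  rw [Finset.sum_insert, Finset.sum_insert, Finset.sum_insert, Finset.sum_singleton]
  · simp only [Prod.mk_add_mk, Prod.mk_sub_mk, add_zero, sub_zero]
    ring
  · simp; omega
  · simp
  · simp; omega

lemma extendC_off (Λ : Finset Site) (g : {x // x ∈ Λ} → ℤ) (x : Site) (hx : x ∉ Λ) :
    extendC Λ 0 g x = 0 := by simp [extendC, hx]

/-- gradient map -/
def gradD (Λ : Finset Site) : ({x // x ∈ Λ} → ℤ) →+ (edgeE Λ → ℤ) where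
  toFun g p := extendC Λ 0 g p.1.2 - extendC Λ 0 g p.1.1
  map_zero' := by ext p; simp [extendC]
  map_add' g h := by
    ext p
    simp only [extendC, Pi.add_apply, Pi.zero_apply]
    split_ifs <;> ring

lemma mem_edgeE_h (Λ : Finset Site) (x : Site) (hx : x ∈ Λ) : (x, x + (1,0)) ∈ edgeE Λ := by
  simp only [edgeE, Finset.mem_union, Finset.mem_image]
  exact Or.inl ⟨x, by simp [baseB, hx], rfl⟩

lemma gradD_inj (Λ : Finset Site) : Function.Injective (gradD Λ) := by
  rw [injective_iff_map_eq_zero]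
  intro g hg
  have step : ∀ x ∈ Λ, extendC Λ 0 g (x + (1,0)) = extendC Λ 0 g x := by
    intro x hx
    have := congrFun hg ⟨_, mem_edgeE_h Λ x hx⟩
    simp only [gradD, AddMonoidHom.coe_mk, ZeroHom.coe_mk, Pi.zero_apply] at this
    omega
  have main : ∀ x, extendC Λ 0 g x = 0 := by
    intro x
    by_contra hne
    have hall : ∀ n : ℕ, extendC Λ 0 g (x.1 + n, x.2) = extendC Λ 0 g x := by
      intro n
      induction n with
      | zero => simp
      | succ n ih =>
        have hm : ((x.1 + n, x.2) : Site) ∈ Λ := by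
          by_contra h
          rw [extendC_off Λ g _ h] at ih
          exact hne ih.symm
        rw [← ih, ← step _ hm]
        congr 1
        ext <;> simp; ring
    have hm : ∀ n : ℕ, ((x.1 + n, x.2) : Site) ∈ Λ := by
      intro n
      by_contra h
      have := hall n
      rw [extendC_off Λ g _ h] at this
      exact hne this.symm
    have hinj : Function.Injective (fun n : ℕ => ((x.1 + n, x.2) : Site)) := by
      intro a b h
      simpa using h
    exact Set.infinite_of_injective_forall_mem hinj hm Λ.finite_toSet
  ext ⟨x, hx⟩
  have := main x
  simpa [extendC, hx] using this

lemma gWeight_eq (β : ℝ) (Λ : Finset Site) (g : {x // x ∈ Λ} → ℤ) :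
    ENNReal.ofReal (gWeight β Λ 0 Set.univ (fun _ => 0) (extendC Λ 0 g)) =
      ∏ p, (ENNReal.ofReal (Real.exp (-β))) ^ (gradD Λ g p).natAbs := by
  rw [gWeight, if_pos (by simp), sosH_eq Λ _ (extendC_off Λ g), add_zero, Finset.mul_sum,
    Real.exp_sum, ENNReal.ofReal_prod_of_nonneg (fun _ _ => (Real.exp_pos _).le),
    ← Finset.prod_coe_sort]
  refine Finset.prod_congr rfl fun p _ => ?_
  rw [← ENNReal.ofReal_pow (Real.exp_pos _).le, ← Real.exp_nat_mul]
  congr 2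
  simp only [gradD, AddMonoidHom.coe_mk, ZeroHom.coe_mk]
  rw [mul_comm, Nat.cast_natAbs]

lemma edge_mem (Λ : Finset Site) (e : Site × Site)
    (he : e.2 = (e.1.1 + 1, e.1.2) ∨ e.2 = (e.1.1, e.1.2 + 1)) (h : e.1 ∈ Λ ∨ e.2 ∈ Λ) :
    e ∈ edgeE Λ := by
  obtain ⟨⟨u, v⟩, f⟩ := e
  simp only [edgeE, baseB, Finset.mem_union, Finset.mem_image]
  rcases he with he | he <;> simp only at he h <;> subst he
  · refine Or.inl ⟨(u, v), ?_, by simp⟩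
    rcases h with h | h
    · exact Or.inl (Or.inl h)
    · exact Or.inl (Or.inr ⟨_, h, by simp⟩)
  · refine Or.inr ⟨(u, v), ?_, by simp⟩
    rcases h with h | h
    · exact Or.inl (Or.inl h)
    · exact Or.inr ⟨_, h, by simp⟩

/-- Lemma A.3 of the paper, Peierls estimate. Identify each dual
bond with the primal edge it crosses (oriented to the right or upwards). There is
`β₀ > 0` such that for all `β ≥ β₀`, all finite connected `Λ ⊂ ℤ²` and all sets `V` of
dual bonds, the SOS measure `π̂_Λ^0` without floor and ceiling and zero boundary
conditions satisfies `π̂_Λ^0(S(η) ⊇ V) ≤ e^{−(β−β₀)|V|}`, where `S(η)` is the set of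
dual bonds across which the gradient of `η` is nonzero. -/
theorem sos_peierls_gradient_estimate :
    ∃ β₀ : ℝ, 0 < β₀ ∧ ∀ β : ℝ, β₀ ≤ β → ∀ Λ : Finset Site, FinsetConn Λ →
      ∀ V : Finset (Site × Site),
        (∀ e ∈ V, e.2 = (e.1.1 + 1, e.1.2) ∨ e.2 = (e.1.1, e.1.2 + 1)) →
        gProb β Λ 0 Set.univ (fun _ => 0) {η | ∀ e ∈ V, η e.2 ≠ η e.1} ≤
          Real.exp (-(β - β₀) * (V.card : ℝ)) := by
  refine ⟨Real.log 4, Real.log_pos (by norm_num), ?_⟩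
  intro β hβ Λ _ V hV
  set A : Set Config := {η | ∀ e ∈ V, η e.2 ≠ η e.1} with hA
  set w := gWeight β Λ 0 Set.univ (fun _ => 0) with hw
  have hw0 : ∀ η, 0 ≤ w η := by
    intro η; simp only [hw, gWeight]; split_ifs
    · exact (Real.exp_pos _).le
    · exact le_rfl
  have hi0 : ∀ η, 0 ≤ A.indicator w η := fun η => Set.indicator_nonneg (fun η _ => hw0 η) η
  have hile : ∀ η, A.indicator w η ≤ w η := fun η => Set.indicator_le_self' (fun η _ => hw0 η) η
  change (∑' g : {x // x ∈ Λ} → ℤ, A.indicator w (extendC Λ 0 g))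
    / ∑' g : {x // x ∈ Λ} → ℤ, w (extendC Λ 0 g) ≤ _
  by_cases hs : Summable (fun g : {x // x ∈ Λ} → ℤ => w (extendC Λ 0 g))
  swap
  · rw [tsum_eq_zero_of_not_summable hs, div_zero]; exact (Real.exp_pos _).le
  have hsi : Summable (fun g : {x // x ∈ Λ} → ℤ => A.indicator w (extendC Λ 0 g)) :=
    Summable.of_nonneg_of_le (fun g => hi0 _) (fun g => hile _) hs
  by_cases hVE : V ⊆ edgeE Λ
  swap
  · have : ∀ g : {x // x ∈ Λ} → ℤ, A.indicator w (extendC Λ 0 g) = 0 := by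
      intro g
      apply Set.indicator_of_notMem
      intro hg
      apply hVE
      intro e he
      apply edge_mem Λ e (hV e he)
      by_contra hc
      push Not at hc
      apply hg e he
      rw [extendC_off Λ g _ hc.1, extendC_off Λ g _ hc.2]
    simp only [this, tsum_zero, zero_div]
    exact (Real.exp_pos _).le
  apply div_le_of_le_mul₀ (tsum_nonneg fun g => hw0 _) (Real.exp_pos _).le
  have hq : ENNReal.ofReal (Real.exp (-β)) ≤ 1/4 := by
    have h4 : Real.exp (-β) ≤ 1/4 := by
      calc Real.exp (-β) ≤ Real.exp (-Real.log 4) := Real.exp_le_exp.2 (by linarith)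
        _ = 1/4 := by rw [Real.exp_neg, Real.exp_log (by norm_num)]; norm_num
    calc _ ≤ ENNReal.ofReal (1/4) := ENNReal.ofReal_le_ofReal h4
      _ = 1/4 := by rw [ENNReal.ofReal_div_of_pos (by norm_num)]; simp
  let V' : Finset (edgeE Λ) := V.subtype (fun p => p ∈ edgeE Λ)
  have hcard : V'.card = V.card := by
    rw [Finset.card_subtype, Finset.filter_true_of_mem (fun x hx => hVE hx)]
  have hp := peierls (gradD Λ) (gradD_inj Λ) V' _ hq
  simp_rw [← gWeight_eq] at hp
  rw [hcard] at hp
  have hexp : ENNReal.ofReal (Real.exp (-(β - Real.log 4) * (V.card:ℝ))) =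
      (4 * ENNReal.ofReal (Real.exp (-β))) ^ V.card := by
    have : Real.exp (-(β - Real.log 4) * (V.card:ℝ)) = (4 * Real.exp (-β)) ^ V.card := by
      rw [mul_comm, Real.exp_nat_mul, neg_sub, sub_eq_add_neg, Real.exp_add,
        Real.exp_log (by norm_num)]
    rw [this, ENNReal.ofReal_pow (by positivity), ENNReal.ofReal_mul (by norm_num)]
    simp
  rw [← hexp, ← hw, ← ENNReal.ofReal_tsum_of_nonneg (fun g => hw0 _) hs,
    ← ENNReal.ofReal_mul (Real.exp_pos _).le] at hp
  rw [← ENNReal.ofReal_le_ofReal_iff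
    (mul_nonneg (Real.exp_pos _).le (tsum_nonneg fun g => hw0 _))]
  refine le_trans (le_of_eq ?_) hp
  rw [ENNReal.ofReal_tsum_of_nonneg (fun g => hi0 _) hsi]
  congr 1; ext g
  have hiff : extendC Λ 0 g ∈ A ↔ ∀ i ∈ V', gradD Λ g i ≠ 0 := by
    constructor
    · intro h i hi
      have := h i.1 (by simpa [V'] using hi)
      simp only [gradD, AddMonoidHom.coe_mk, ZeroHom.coe_mk]
      exact sub_ne_zero.2 this
    · intro h e he
      have := h ⟨e, hVE he⟩ (by simpa [V'] using he)
      simp only [gradD, AddMonoidHom.coe_mk, ZeroHom.coe_mk] at this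
      exact sub_ne_zero.1 this
  by_cases h : extendC Λ 0 g ∈ A
  · rw [Set.indicator_of_mem h, if_pos (hiff.1 h)]
  · rw [Set.indicator_of_notMem h, if_neg (fun h' => h (hiff.2 h'))]; simp


end SOSPaper
end
end
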